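/- arXiv:2001.03741 — 14 statements merged into one kernel-verified Lean document; each statement's English description precedes it below -/
import Mathlib

section
/- If (p, n, γ, ρ) together with a monic polynomial E ∈ ℤ[X] of degree n satisfying E(γ) ≡ 0 (mod p) is a Polynomial Modular Number System, then p ≤ (2ρ − 1)^n. -/
open Polynomial

/-- A Polynomial Modular Number System `(p, n, γ, ρ)_E`. -/
def IsPMNS (p n : ℕ) (γ ρ : ℤ) (E : Polynomial ℤ) : Prop :=
  2 ≤ p ∧ 2 ≤ n ∧ 0 < γ ∧ γ < (p : ℤ) ∧ 2 ≤ ρ ∧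
  E.Monic ∧ E.natDegree = n ∧ (p : ℤ) ∣ E.eval γ ∧
  ∀ x : ℤ, 0 ≤ x → x < (p : ℤ) →
    ∃ c : Fin n → ℤ, (∀ i, -ρ < c i ∧ c i < ρ) ∧
      (p : ℤ) ∣ (∑ i, c i * γ ^ (i : ℕ)) - x

/-- If `(p, n, γ, ρ)` together with a monic polynomial `E ∈ ℤ[X]` of degree `n`
satisfying `E(γ) ≡ 0 (mod p)` is a PMNS, then `p ≤ (2ρ − 1)^n`. -/
theorem pmns_card_bound (p n : ℕ) (γ ρ : ℤ) (E : Polynomial ℤ)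
    (h : IsPMNS p n γ ρ E) : (p : ℤ) ≤ (2 * ρ - 1) ^ n := by
  obtain ⟨-, -, -, -, hρ, -, -, -, hrep⟩ := h
  have hrange : ∀ x ∈ Finset.Ico (0 : ℤ) p,
      ∃ c ∈ Fintype.piFinset fun _ : Fin n => Finset.Ioo (-ρ) ρ,
        (∑ i, c i * γ ^ (i : ℕ)) % p = x := by
    intro x hx
    obtain ⟨hx0, hxp⟩ := Finset.mem_Ico.mp hx
    obtain ⟨c, hc, hdvd⟩ := hrep x hx0 hxp
    refine ⟨c, by simpa [Fintype.mem_piFinset] using hc, ?_⟩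
    refine Eq.trans ?_ (Int.emod_eq_of_lt hx0 hxp)
    exact Int.emod_eq_emod_iff_emod_sub_eq_zero.mpr (Int.emod_eq_zero_of_dvd hdvd)
  have hcard := Finset.card_le_card_of_surjOn
    (fun c : Fin n → ℤ => (∑ i, c i * γ ^ (i : ℕ)) % (p : ℤ)) hrange
  have hlen : ((ρ - -ρ - 1).toNat : ℤ) = 2 * ρ - 1 := by omega
  simp only [Fintype.card_piFinset, Int.card_Ico, Int.card_Ioo, Finset.prod_const,
    Finset.card_univ, Fintype.card_fin, sub_zero, Int.toNat_natCast] at hcard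
  rw [← hlen]
  exact_mod_cast hcard
end

section
/- Let p ≥ 2 and n ≥ 2 be integers, let E ∈ ℤ[X] be a monic polynomial of degree n, and let γ ∈ {0, …, p−1} satisfy E(γ) ≡ 0 (mod p). Let L = {(v_0, …, v_{n−1}) ∈ ℤ^n : Σ_{i=0}^{n−1} v_i γ^i ≡ 0 (mod p)}. Suppose r is a real number such that for every T ∈ ℝ^n there exists V ∈ L with Euclidean distance ‖T − V‖₂ ≤ r (i.e., r is at least the covering radius of the lattice L). If ρ is an integer with ρ > r, then (p, n, γ, ρ)_E is a PMNS: for every integer x there exist integers x_0, …, x_{n−1} with |x_i| < ρ for all i and Σ_{i=0}^{n−1} x_i γ^i ≡ x (mod p). -/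
open Polynomial

/-- Theorem 1 (covering radius criterion): let `p ≥ 2`, `n ≥ 2`, `E ∈ ℤ[X]` monic of degree `n`,
`γ ∈ {0, …, p−1}` with `E(γ) ≡ 0 (mod p)`, and let
`L = {v ∈ ℤ^n : Σ v_i γ^i ≡ 0 (mod p)}`.  If `r` bounds the covering radius of `L`
(for every `T ∈ ℝ^n` there is `V ∈ L` with `‖T − V‖₂ ≤ r`) and `ρ > r`, then
`(p, n, γ, ρ)_E` is a PMNS: every integer `x` has a representation
`x ≡ Σ x_i γ^i (mod p)` with `|x_i| < ρ`. -/
theorem pmns_of_covering_radius (p n : ℕ) (hp : 2 ≤ p) (hn : 2 ≤ n)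
    (E : Polynomial ℤ) (hE : E.Monic) (hdeg : E.natDegree = n)
    (γ : ℤ) (hγ0 : 0 ≤ γ) (hγp : γ < (p : ℤ))
    (hroot : (p : ℤ) ∣ E.eval γ)
    (r : ℝ)
    (hcov : ∀ T : Fin n → ℝ, ∃ V : Fin n → ℤ,
      ((p : ℤ) ∣ ∑ i, V i * γ ^ (i : ℕ)) ∧
      Real.sqrt (∑ i, (T i - (V i : ℝ)) ^ 2) ≤ r)
    (ρ : ℤ) (hρ : r < (ρ : ℝ)) :
    ∀ x : ℤ, ∃ c : Fin n → ℤ, (∀ i, |c i| < ρ) ∧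
      (p : ℤ) ∣ (∑ i, c i * γ ^ (i : ℕ)) - x := by
  intro x
  have hn0 : 0 < n := by omega
  let T : Fin n → ℤ := Pi.single ⟨0, hn0⟩ x
  obtain ⟨V, hV, hdist⟩ := hcov fun i => (T i : ℝ)
  refine ⟨fun i => T i - V i, fun i => ?_, ?_⟩
  · have hcoord : |(T i : ℝ) - V i| ≤ Real.sqrt (∑ j, ((T j : ℝ) - V j) ^ 2) :=
      Real.abs_le_sqrt (Finset.single_le_sum (f := fun j => ((T j : ℝ) - V j) ^ 2)
        (fun j _ => sq_nonneg _) (Finset.mem_univ i))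
    have hlt : |(T i : ℝ) - V i| < ρ := (hcoord.trans hdist).trans_lt hρ
    exact_mod_cast hlt
  · have hT : ∑ i, T i * γ ^ (i : ℕ) = x := by
      rw [Finset.sum_eq_single ⟨0, hn0⟩] <;> simp +contextual [T]
    simpa [sub_mul, Finset.sum_sub_distrib, hT] using hV
end

section
/- Let p ≥ 2 and n ≥ 2 be integers, let E ∈ ℤ[X] be a monic polynomial of degree n, and let γ ∈ {0, …, p−1} satisfy E(γ) ≡ 0 (mod p). Let L = {(v_0, …, v_{n−1}) ∈ ℤ^n : Σ_{i=0}^{n−1} v_i γ^i ≡ 0 (mod p)}. Let B = (b_{i,j})_{0≤i,j<n} be an n×n integer matrix whose rows all belong to L and with det B ≠ 0. If ρ is an integer with 2ρ > max_{0≤j<n} Σ_{i=0}^{n−1} |b_{i,j}| (i.e., ρ > ½‖B‖₁, where ‖B‖₁ denotes the maximum over columns of the sum of the absolute values of the entries of that column), then (p, n, γ, ρ)_E is a PMNS: for every integer x there exist integers x_0, …, x_{n−1} with |x_i| < ρ for all i and Σ_{i=0}^{n−1} x_i γ^i ≡ x (mod p). -/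
open Polynomial

/-- Babai rounding: if `B` is nonsingular and its column sums of absolute values are all less than
`2 * ρ`, then every integer vector is congruent, modulo the row lattice of `B`, to a vector with
entries of absolute value less than `ρ`. -/
theorem Matrix.exists_abs_sub_vecMul_lt {ι : Type*} [Fintype ι] [DecidableEq ι]
    (B : Matrix ι ι ℤ) (hdet : B.det ≠ 0) (ρ : ℤ) (hρ : ∀ j, ∑ i, |B i j| < 2 * ρ)
    (a : ι → ℤ) : ∃ k : ι → ℤ, ∀ j, |a j - ∑ i, k i * B i j| < ρ := by
  set M : Matrix ι ι ℚ := B.map (Int.castRingHom ℚ) with hM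
  have hunit : IsUnit M.det := by
    have h : M.det = (B.det : ℚ) := ((Int.castRingHom ℚ).map_det B).symm
    rw [h]
    exact isUnit_iff_ne_zero.mpr (Int.cast_ne_zero.mpr hdet)
  set t : ι → ℚ := Matrix.vecMul (fun i => (a i : ℚ)) M⁻¹ with ht
  have hsolve (j : ι) : ∑ i, t i * (B i j : ℚ) = a j := by
    have h : Matrix.vecMul t M = fun i => (a i : ℚ) := by
      rw [ht, Matrix.vecMul_vecMul, Matrix.nonsing_inv_mul _ hunit, Matrix.vecMul_one]
    simpa [Matrix.vecMul, dotProduct, hM] using congrFun h j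
  refine ⟨fun i => round (t i), fun j => ?_⟩
  have hbound : |(a j : ℚ) - ∑ i, (round (t i) : ℚ) * B i j| ≤ 1 / 2 * ∑ i, |(B i j : ℚ)| := by
    rw [← hsolve j, ← Finset.sum_sub_distrib, Finset.mul_sum]
    refine (Finset.abs_sum_le_sum_abs _ _).trans (Finset.sum_le_sum fun i _ => ?_)
    rw [← sub_mul, abs_mul]
    exact mul_le_mul_of_nonneg_right (abs_sub_round (t i)) (abs_nonneg _)
  have hcol : ∑ i, |(B i j : ℚ)| < 2 * ρ := by exact_mod_cast hρ j
  have hlt : |(a j : ℚ) - ∑ i, (round (t i) : ℚ) * B i j| < ρ := by linarith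
  exact_mod_cast hlt

/-- Theorem 2 (norm-1 bound criterion): let `p ≥ 2`, `n ≥ 2`, `E ∈ ℤ[X]` monic of degree `n`,
`γ ∈ {0, …, p−1}` with `E(γ) ≡ 0 (mod p)`.  Let `B` be an `n×n` integer matrix whose rows
all lie in the lattice `L = {v ∈ ℤ^n : Σ v_i γ^i ≡ 0 (mod p)}` and with `det B ≠ 0`.
If `2ρ > ‖B‖₁ = max_j Σ_i |b_{i,j}|`, then `(p, n, γ, ρ)_E` is a PMNS: every integer `x`
has a representation `x ≡ Σ x_i γ^i (mod p)` with `|x_i| < ρ`. -/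
theorem pmns_of_matrix_norm_one (p n : ℕ) (hp : 2 ≤ p) (hn : 2 ≤ n)
    (E : Polynomial ℤ) (hE : E.Monic) (hdeg : E.natDegree = n)
    (γ : ℤ) (hγ0 : 0 ≤ γ) (hγp : γ < (p : ℤ))
    (hroot : (p : ℤ) ∣ E.eval γ)
    (B : Matrix (Fin n) (Fin n) ℤ)
    (hrows : ∀ i, (p : ℤ) ∣ ∑ j, B i j * γ ^ (j : ℕ))
    (hdet : B.det ≠ 0)
    (ρ : ℤ) (hρ : ∀ j, ∑ i, |B i j| < 2 * ρ) :
    ∀ x : ℤ, ∃ c : Fin n → ℤ, (∀ i, |c i| < ρ) ∧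
      (p : ℤ) ∣ (∑ i, c i * γ ^ (i : ℕ)) - x := by
  intro x
  obtain ⟨k, hk⟩ := B.exists_abs_sub_vecMul_lt hdet ρ hρ (Pi.single ⟨0, by omega⟩ x)
  refine ⟨_, hk, ?_⟩
  have hsingle : ∑ j : Fin n, (Pi.single ⟨0, by omega⟩ x : Fin n → ℤ) j * γ ^ (j : ℕ) = x := by
    rw [Finset.sum_eq_single ⟨0, by omega⟩]
    · simp
    · intro j _ hj
      simp [hj]
    · simp
  have hlattice : ∑ j : Fin n, (∑ i, k i * B i j) * γ ^ (j : ℕ) =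
      ∑ i, k i * ∑ j, B i j * γ ^ (j : ℕ) := by
    simp_rw [Finset.sum_mul, Finset.mul_sum, mul_assoc]
    exact Finset.sum_comm
  simp_rw [sub_mul, Finset.sum_sub_distrib]
  rw [hsingle, hlattice, sub_sub_cancel_left, dvd_neg]
  exact Finset.dvd_sum fun i _ => (hrows i).mul_left (k i)
end

section
/- Let p ≥ 2 and n ≥ 2 be integers, E ∈ ℤ[X] a monic polynomial of degree n, γ ∈ {0, …, p−1} with E(γ) ≡ 0 (mod p), and L the associated lattice. Let V = (v_0, …, v_{n−1}) ∈ L be a nonzero vector and V(X) = Σ_{i=0}^{n−1} v_i X^i the corresponding polynomial. Assume V(X) is invertible modulo E(X), i.e., there exists W ∈ ℚ[X] with V(X)·W(X) ≡ 1 (mod E(X)) in ℚ[X]. For 0 ≤ i ≤ n−1, let B_i ∈ ℤ^n be the coefficient vector of the polynomial X^i·V(X) mod E(X) (which has integer coefficients since E is monic). Then the vectors B_0, …, B_{n−1} are linearly independent over ℚ and each B_i belongs to L; consequently they generate a rank-n sublattice L′ ⊆ L which contains V. -/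
open Polynomial

theorem Polynomial.modByMonic_eq_sum_fin {R : Type*} [CommRing R] {n : ℕ} {E : R[X]}
    (hE : E.Monic) (hE1 : E ≠ 1) (hdeg : E.natDegree = n) (P : R[X]) :
    P %ₘ E = ∑ j : Fin n, C ((P %ₘ E).coeff j) * X ^ (j : ℕ) := by
  rw [Fin.sum_univ_eq_sum_range (fun j => C ((P %ₘ E).coeff j) * X ^ j) n]
  exact as_sum_range_C_mul_X_pow' _ (hdeg ▸ natDegree_modByMonic_lt P hE hE1)

theorem Polynomial.coeff_sum_fin {R : Type*} [Semiring R] {n : ℕ} (v : Fin n → R) (j : Fin n) :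
    (∑ k, C (v k) * X ^ (k : ℕ)).coeff (j : ℕ) = v j := by
  simp [coeff_C_mul, coeff_X_pow, Fin.val_inj]

/-- Evaluation at a root of `E` modulo `p` is unchanged, modulo `p`, by reduction modulo `E`. -/
theorem Polynomial.dvd_eval_modByMonic {R : Type*} [CommRing R] {E P : R[X]} {p γ : R}
    (hroot : p ∣ E.eval γ) (hP : p ∣ P.eval γ) : p ∣ (P %ₘ E).eval γ := by
  rw [modByMonic_eq_sub_mul_div, eval_sub, eval_mul]
  exact dvd_sub hP (hroot.mul_right _)

/-- Proposition (sublattice from an invertible vector): let `p ≥ 2`, `n ≥ 2`, `E ∈ ℤ[X]`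
monic of degree `n`, `γ ∈ {0, …, p−1}` with `E(γ) ≡ 0 (mod p)`, and let
`L = {v ∈ ℤ^n : Σ v_i γ^i ≡ 0 (mod p)}`.  Let `V ∈ L` be nonzero, with associated polynomial
`V(X) = Σ v_i X^i`, and assume `V(X)` is invertible modulo `E(X)` over `ℚ`.
Let `B_i` be the coefficient vector of `X^i · V(X) mod E(X)`.  Then `B_0, …, B_{n−1}` are
linearly independent over `ℚ`, each `B_i ∈ L`, and `V` lies in the sublattice they generate. -/
theorem sublattice_of_invertible_vector (p n : ℕ) (hp : 2 ≤ p) (hn : 2 ≤ n)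
    (E : Polynomial ℤ) (hE : E.Monic) (hdeg : E.natDegree = n)
    (γ : ℤ) (hγ0 : 0 ≤ γ) (hγp : γ < (p : ℤ))
    (hroot : (p : ℤ) ∣ E.eval γ)
    (V : Fin n → ℤ) (hVne : V ≠ 0)
    (hVL : (p : ℤ) ∣ ∑ i, V i * γ ^ (i : ℕ))
    (W : Polynomial ℚ)
    (hW : (E.map (Int.castRingHom ℚ)) ∣
      ((∑ i, C (V i) * X ^ (i : ℕ)).map (Int.castRingHom ℚ)) * W - 1)
    (B : Fin n → Fin n → ℤ)
    (hB : ∀ i j, B i j =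
      ((X ^ (i : ℕ) * ∑ k, C (V k) * X ^ (k : ℕ)) %ₘ E).coeff (j : ℕ)) :
    LinearIndependent ℚ (fun i : Fin n => fun j : Fin n => (B i j : ℚ)) ∧
    (∀ i, (p : ℤ) ∣ ∑ j, B i j * γ ^ (j : ℕ)) ∧
    V ∈ Submodule.span ℤ (Set.range B) := by
  have hE1 : E ≠ 1 := by
    rintro rfl
    rw [natDegree_one] at hdeg
    omega
  have hBsum : ∀ i : Fin n, (X ^ (i : ℕ) * ∑ k, C (V k) * X ^ (k : ℕ)) %ₘ E =
      ∑ j, C (B i j) * X ^ (j : ℕ) := by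
    intro i
    rw [modByMonic_eq_sum_fin hE hE1 hdeg]
    exact Finset.sum_congr rfl fun j _ => by rw [hB]
  refine ⟨?_, ?_, ?_⟩
  · rw [Fintype.linearIndependent_iff]
    intro g hg
    set φ := Int.castRingHom ℚ
    set VX : ℤ[X] := ∑ k, C (V k) * X ^ (k : ℕ)
    set G : ℚ[X] := ∑ i, C (g i) * X ^ (i : ℕ) with hG
    have hzero : ∑ i, C (g i) * (∑ j, C (B i j) * X ^ (j : ℕ) : ℤ[X]).map φ = 0 := by
      simp only [Polynomial.map_sum, Polynomial.map_mul, Polynomial.map_pow, map_C, map_X,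
        Finset.mul_sum]
      rw [Finset.sum_comm]
      refine Finset.sum_eq_zero fun j _ => ?_
      have hj := congrFun hg j
      simp only [Finset.sum_apply, Pi.smul_apply, smul_eq_mul, Pi.zero_apply] at hj
      simp_rw [← mul_assoc, ← C_mul]
      rw [← Finset.sum_mul, ← map_sum]
      simp [φ, hj]
    have hGV : E.map φ ∣ G * VX.map φ := by
      have hsub : G * VX.map φ = ∑ i : Fin n, C (g i) *
          ((X ^ (i : ℕ) * VX).map φ - (∑ j, C (B i j) * X ^ (j : ℕ) : ℤ[X]).map φ) := by
        simp_rw [mul_sub]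
        rw [Finset.sum_sub_distrib, hzero, sub_zero, hG, Finset.sum_mul]
        simp [mul_assoc]
      rw [hsub]
      refine Finset.dvd_sum fun i _ => Dvd.dvd.mul_left ?_ _
      rw [← hBsum, ← Polynomial.map_sub]
      refine Polynomial.map_dvd φ ?_
      rw [modByMonic_eq_sub_mul_div, sub_sub_cancel]
      exact dvd_mul_right _ _
    have hEG : E.map φ ∣ G := by
      have h := dvd_sub (hGV.mul_right W) (hW.mul_left G)
      rwa [show G * VX.map φ * W - G * (VX.map φ * W - 1) = G by ring] at h
    have hG0 : G = 0 := by
      refine eq_zero_of_dvd_of_degree_lt hEG ?_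
      rw [hE.degree_map, degree_eq_natDegree hE.ne_zero, hdeg]
      exact degree_sum_fin_lt g
    intro i
    rw [← coeff_sum_fin g i, ← hG, hG0, coeff_zero]
  · intro i
    have h := dvd_eval_modByMonic (P := X ^ (i : ℕ) * ∑ k, C (V k) * X ^ (k : ℕ)) hroot (by
      simpa [eval_finsetSum] using hVL.mul_left _)
    rw [hBsum] at h
    simpa [eval_finsetSum] using h
  · refine Submodule.subset_span ⟨⟨0, by omega⟩, funext fun j => ?_⟩
    have hlt : (∑ k, C (V k) * X ^ (k : ℕ)).degree < E.degree := by
      rw [degree_eq_natDegree hE.ne_zero, hdeg]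
      exact degree_sum_fin_lt V
    rw [hB, pow_zero, one_mul, (modByMonic_eq_self_iff hE).2 hlt, coeff_sum_fin]
end

section
/- Let p ≥ 2 and n ≥ 2 be integers, E ∈ ℤ[X] a monic polynomial of degree n that is irreducible over ℚ, γ ∈ {0, …, p−1} with E(γ) ≡ 0 (mod p), and L the associated lattice. Let A be the n×n integer matrix whose row 0 is (p, 0, …, 0) and whose row i (for 1 ≤ i ≤ n−1) has entry −γ in position i−1, entry 1 in position i, and 0 elsewhere; let C be the companion matrix of E. Let t ∈ ℤ^n be such that V_0 = t·A is nonzero, and set V_j = V_0·C^j for 1 ≤ j ≤ n−1 (so that (V_0, V_1, …, V_{n−1}) is a nonzero element of the lattice of rank n in ℤ^{n²} generated by the rows of the block matrix D = (A | AC | ⋯ | AC^{n−1})). Then V_0 ∈ L, and the vectors V_0, V_1, …, V_{n−1} all belong to L and are linearly independent over ℚ, hence form a basis of a rank-n sublattice L′ ⊆ L. -/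
open Polynomial

/-- The vector of powers of a root of `E` is an eigenvector of the companion matrix of `E`. -/
lemma companion_mulVec_pow {S : Type*} [CommRing S] {n : ℕ} {E : ℤ[X]} (hE : E.Monic)
    (hdeg : E.natDegree = n) {Cm : Matrix (Fin n) (Fin n) ℤ}
    (hCm : ∀ i j : Fin n, Cm i j =
      if (i : ℕ) = n - 1 then -E.coeff (j : ℕ)
      else if (i : ℕ) + 1 = (j : ℕ) then 1 else 0)
    {r : S} (hr : aeval r E = 0) (i : Fin n) :
    ∑ k, (Cm i k : S) * r ^ (k : ℕ) = r * r ^ (i : ℕ) := by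
  have hi := i.isLt
  by_cases h : (i : ℕ) = n - 1
  · have hsum : ∑ k : Fin n, (E.coeff k : S) * r ^ (k : ℕ) + r ^ n = 0 := by
      rw [aeval_eq_sum_range, hdeg, Finset.sum_range_succ, ← hdeg, hE.coeff_natDegree, hdeg,
        ← Fin.sum_univ_eq_sum_range (fun k => E.coeff k • r ^ k)] at hr
      simpa [zsmul_eq_mul] using hr
    have hpow : r * r ^ (i : ℕ) = r ^ n := by
      rw [← pow_succ', h, Nat.sub_add_cancel (by omega)]
    rw [hpow, ← neg_eq_of_add_eq_zero_right hsum]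
    simp [hCm, h]
  · rw [Finset.sum_eq_single (⟨i + 1, by omega⟩ : Fin n)]
    · simp [hCm, h, pow_succ']
    · intro b _ hb
      have : (i : ℕ) + 1 ≠ b := fun hib => hb (Fin.ext hib.symm)
      simp [hCm, h, this]
    · simp

/-- Multiplying a row vector by a matrix having the powers of `r` as an eigenvector for `r`
multiplies the associated polynomial value at `r` by `r`. -/
lemma sum_vecMul_pow_mul_pow {S : Type*} [CommRing S] {n : ℕ} {M : Matrix (Fin n) (Fin n) ℤ}
    {r : S} (hM : ∀ i, ∑ k, (M i k : S) * r ^ (k : ℕ) = r * r ^ (i : ℕ))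
    (v : Fin n → ℤ) (j : ℕ) :
    ∑ k, ((Matrix.vecMul v (M ^ j) k : ℤ) : S) * r ^ (k : ℕ) =
      r ^ j * ∑ k, (v k : S) * r ^ (k : ℕ) := by
  induction j with
  | zero => simp
  | succ j ih =>
    rw [pow_succ, ← Matrix.vecMul_vecMul, pow_succ', mul_assoc, ← ih]
    generalize Matrix.vecMul v (M ^ j) = w
    simp only [Matrix.vecMul, dotProduct, Int.cast_sum, Int.cast_mul, Finset.sum_mul]
    rw [Finset.sum_comm, Finset.mul_sum]
    refine Finset.sum_congr rfl fun i _ => ?_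
    simp_rw [mul_assoc, ← Finset.mul_sum, hM]
    ring

/-- Every integer combination of the rows of `A` lies in the lattice attached to `p` and `γ`. -/
lemma dvd_sum_vecMul_mul_pow {p : ℤ} {n : ℕ} {γ : ℤ} {A : Matrix (Fin n) (Fin n) ℤ}
    (hA : ∀ i j : Fin n, A i j =
      if (i : ℕ) = 0 then (if (j : ℕ) = 0 then p else 0)
      else if j = i then 1 else if (j : ℕ) + 1 = (i : ℕ) then -γ else 0)
    (t : Fin n → ℤ) : p ∣ ∑ k, Matrix.vecMul t A k * γ ^ (k : ℕ) := by
  simp only [Matrix.vecMul, dotProduct, Finset.sum_mul]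
  rw [Finset.sum_comm]
  refine Finset.dvd_sum fun i _ => ?_
  simp_rw [mul_assoc, ← Finset.mul_sum]
  refine Dvd.dvd.mul_left ?_ _
  by_cases h : (i : ℕ) = 0
  · refine Finset.dvd_sum fun k _ => Dvd.dvd.mul_right ?_ _
    rw [hA, if_pos h]
    split_ifs <;> simp
  · have hi := i.isLt
    have hne : i ≠ ⟨i - 1, by omega⟩ := fun he => by
      have := congrArg Fin.val he
      simp only at this
      omega
    rw [Finset.sum_eq_add i ⟨i - 1, by omega⟩ hne]
    · have hpow : γ ^ (i : ℕ) = γ * γ ^ ((i : ℕ) - 1) := by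
        rw [← pow_succ', Nat.sub_add_cancel (by omega)]
      simp [hA, h, hne.symm, Nat.sub_add_cancel (Nat.pos_of_ne_zero h), hpow]
    · rintro k - ⟨hk, hk'⟩
      have : (k : ℕ) + 1 ≠ i := fun he => hk' (Fin.ext (by simp only; omega))
      simp [hA, h, hk, this]
    · simp
    · simp

/-- The powers below the degree of the root adjoined by a polynomial are independent. -/
lemma linearIndependent_root_pow {K : Type*} [Field K] {f : K[X]} (hf : f ≠ 0) {n : ℕ}
    (hn : f.natDegree = n) :
    LinearIndependent K fun i : Fin n => AdjoinRoot.root f ^ (i : ℕ) := by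
  subst hn
  have h := (AdjoinRoot.powerBasis hf).basis.linearIndependent
  rwa [PowerBasis.coe_basis] at h

/-- If the powers of `θ` below `n` are independent over `ℚ` and form an eigenvector of `M` for `θ`,
then the iterates of `M` on a nonzero integer row vector are independent over `ℚ`. -/
lemma linearIndependent_vecMul_pow {K : Type*} [Field K] [Algebra ℚ K] {n : ℕ}
    {M : Matrix (Fin n) (Fin n) ℤ} {θ : K}
    (hM : ∀ i, ∑ k, (M i k : K) * θ ^ (k : ℕ) = θ * θ ^ (i : ℕ))
    (hind : LinearIndependent ℚ fun i : Fin n => θ ^ (i : ℕ)) {v : Fin n → ℤ} (hv : v ≠ 0) :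
    LinearIndependent ℚ
      (fun j : Fin n => fun k : Fin n => ((Matrix.vecMul v (M ^ (j : ℕ))) k : ℚ)) := by
  have hx : ∑ k, (v k : K) * θ ^ (k : ℕ) ≠ 0 := fun h0 => hv <| by
    ext k
    have := Fintype.linearIndependent_iff.1 hind (fun k => (v k : ℚ))
      (by simpa [Algebra.smul_def] using h0) k
    exact_mod_cast this
  refine LinearIndependent.of_comp
    (Fintype.linearCombination ℚ fun i : Fin n => θ ^ (i : ℕ)) ?_
  have hmul := hind.map' (LinearMap.mulRight ℚ (∑ k, (v k : K) * θ ^ (k : ℕ)))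
    (LinearMap.ker_eq_bot.2 (mul_left_injective₀ hx))
  have hcomp : (Fintype.linearCombination ℚ fun i : Fin n => θ ^ (i : ℕ)) ∘
      (fun j : Fin n => fun k : Fin n => ((Matrix.vecMul v (M ^ (j : ℕ))) k : ℚ)) =
      LinearMap.mulRight ℚ (∑ k, (v k : K) * θ ^ (k : ℕ)) ∘ fun i : Fin n => θ ^ (i : ℕ) := by
    ext1 j
    simpa [Fintype.linearCombination_apply, Algebra.smul_def] using sum_vecMul_pow_mul_pow hM v j
  exact hcomp ▸ hmul

/-- Corollary (basis built from the block matrix `D = (A | AC | ⋯ | AC^{n−1})`):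
let `p ≥ 2`, `n ≥ 2`, `E ∈ ℤ[X]` monic of degree `n` irreducible over `ℚ`,
`γ ∈ {0, …, p−1}` with `E(γ) ≡ 0 (mod p)`, and `L = {v ∈ ℤ^n : Σ v_i γ^i ≡ 0 (mod p)}`.
Let `A` be the matrix with row `0` equal to `(p,0,…,0)` and row `i ≥ 1` having `−γ` in
position `i−1` and `1` in position `i`; let `Cm` be the companion matrix of `E`.
If `V₀ = t·A` is nonzero and `V_j = V₀·Cm^j`, then `V₀ ∈ L`, all the `V_j` belong to `L`,
and `V₀, …, V_{n−1}` are linearly independent over `ℚ` (hence a basis of a rank-`n`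
sublattice `L′ ⊆ L`). -/
theorem sublattice_basis_of_block_matrix (p n : ℕ) (hp : 2 ≤ p) (hn : 2 ≤ n)
    (E : Polynomial ℤ) (hE : E.Monic) (hdeg : E.natDegree = n)
    (hirr : Irreducible (E.map (Int.castRingHom ℚ)))
    (γ : ℤ) (hγ0 : 0 ≤ γ) (hγp : γ < (p : ℤ))
    (hroot : (p : ℤ) ∣ E.eval γ)
    (A : Matrix (Fin n) (Fin n) ℤ)
    (hA : ∀ i j : Fin n, A i j =
      if (i : ℕ) = 0 then (if (j : ℕ) = 0 then (p : ℤ) else 0)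
      else if j = i then 1 else if (j : ℕ) + 1 = (i : ℕ) then -γ else 0)
    (Cm : Matrix (Fin n) (Fin n) ℤ)
    (hCm : ∀ i j : Fin n, Cm i j =
      if (i : ℕ) = n - 1 then -E.coeff (j : ℕ)
      else if (i : ℕ) + 1 = (j : ℕ) then 1 else 0)
    (t : Fin n → ℤ) (V0 : Fin n → ℤ)
    (hV0 : V0 = Matrix.vecMul t A) (hV0ne : V0 ≠ 0) :
    ((p : ℤ) ∣ ∑ i, V0 i * γ ^ (i : ℕ)) ∧
    (∀ j : Fin n, (p : ℤ) ∣ ∑ k, (Matrix.vecMul V0 (Cm ^ (j : ℕ))) k * γ ^ (k : ℕ)) ∧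
    LinearIndependent ℚ
      (fun j : Fin n => fun k : Fin n => ((Matrix.vecMul V0 (Cm ^ (j : ℕ))) k : ℚ)) := by
  have hV0mem : (p : ℤ) ∣ ∑ i, V0 i * γ ^ (i : ℕ) := hV0 ▸ dvd_sum_vecMul_mul_pow hA t
  refine ⟨hV0mem, fun j => ?_, ?_⟩
  · have hγ : aeval (γ : ZMod p) E = 0 := by
      rw [← eq_intCast (algebraMap ℤ (ZMod p)) γ, aeval_algebraMap_apply, coe_aeval_eq_eval,
        eq_intCast, ZMod.intCast_zmod_eq_zero_iff_dvd _ p]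
      exact hroot
    have h := sum_vecMul_pow_mul_pow (companion_mulVec_pow hE hdeg hCm hγ) V0 j
    rw [← ZMod.intCast_zmod_eq_zero_iff_dvd _ p] at hV0mem ⊢
    push_cast at hV0mem ⊢
    rw [h, hV0mem, mul_zero]
  · set f := E.map (Int.castRingHom ℚ) with hf
    have : Fact (Irreducible f) := ⟨hirr⟩
    have hθ : aeval (AdjoinRoot.root f) E = 0 := by
      rw [← aeval_map_algebraMap ℚ, algebraMap_int_eq, ← hf]
      exact (AdjoinRoot.aeval_eq f).trans AdjoinRoot.mk_self
    have hind : LinearIndependent ℚ fun i : Fin n => AdjoinRoot.root f ^ (i : ℕ) :=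
      linearIndependent_root_pow hirr.ne_zero (by rw [hf, hE.natDegree_map, hdeg])
    exact linearIndependent_vecMul_pow (companion_mulVec_pow hE hdeg hCm hθ) hind hV0ne
end

section
/- Let E(X) = X^n + a_{n−1}X^{n−1} + ⋯ + a_1X + a_0 ∈ ℤ[X] be monic of degree n ≥ 2. Suppose there exist a prime μ and a positive integer α with gcd(α, n) = 1 such that μ^α divides a_0, μ^{α+1} does not divide a_0, and μ^{⌈α(n−i)/n⌉} divides a_i for every 1 ≤ i ≤ n−1. Then E(X) is irreducible in ℤ[X] (equivalently, irreducible over ℚ). -/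
open Polynomial

/-- The `n`-th power of the `p`-adic absolute value on `ℤ`, for `n ≠ 0`. -/
noncomputable def padicAbsPow (p : ℕ) [Fact p.Prime] (n : ℕ) (hn : n ≠ 0) :
    AbsoluteValue ℤ ℝ where
  toFun a := ((padicNorm p a ^ n : ℚ) : ℝ)
  map_mul' a b := by push_cast; rw [padicNorm.mul]; push_cast; ring
  nonneg' a := by exact_mod_cast pow_nonneg (padicNorm.nonneg _) n
  eq_zero' a := by
    constructor
    · intro h
      have h' : padicNorm p a ^ n = 0 := by exact_mod_cast h
      exact_mod_cast padicNorm.zero_of_padicNorm_eq_zero (eq_zero_of_pow_eq_zero h')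
    · rintro rfl
      simp [hn]
  add_le' a b := by
    have ha := pow_nonneg (padicNorm.nonneg (p := p) (a : ℚ)) n
    have hb := pow_nonneg (padicNorm.nonneg (p := p) (b : ℚ)) n
    have h := pow_le_pow_left₀ (padicNorm.nonneg _)
      (padicNorm.nonarchimedean (p := p) (q := a) (r := b)) n
    norm_cast
    push_cast
    rcases max_choice (padicNorm p a) (padicNorm p b) with e | e <;> rw [e] at h <;> linarith

theorem padicAbsPow_apply (p : ℕ) [Fact p.Prime] (n : ℕ) (hn : n ≠ 0) (a : ℤ) :
    padicAbsPow p n hn a = ((padicNorm p a ^ n : ℚ) : ℝ) := rfl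

theorem isNonarchimedean_padicAbsPow (p : ℕ) [Fact p.Prime] (n : ℕ) (hn : n ≠ 0) :
    IsNonarchimedean (padicAbsPow p n hn) := by
  intro a b
  have h := pow_le_pow_left₀ (padicNorm.nonneg _)
    (padicNorm.nonarchimedean (p := p) (q := a) (r := b)) n
  simp only [padicAbsPow_apply]
  norm_cast
  push_cast
  rcases max_choice (padicNorm p a) (padicNorm p b) with e | e <;> rw [e] at h
  · exact h.trans (le_max_left _ _)
  · exact h.trans (le_max_right _ _)

theorem padicAbsPow_eq {p : ℕ} [Fact p.Prime] {n : ℕ} (hn : n ≠ 0) {a : ℤ} (ha : a ≠ 0) :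
    padicAbsPow p n hn a = (p : ℝ)⁻¹ ^ (n * padicValInt p a) := by
  rw [padicAbsPow_apply, padicNorm.eq_zpow_of_nonzero (by exact_mod_cast ha), padicValRat.of_int]
  simp [pow_mul']

theorem padicAbsPow_le_of_dvd {p : ℕ} [hp : Fact p.Prime] {n : ℕ} (hn : n ≠ 0) {a : ℤ} {k m : ℕ}
    (hk : (p : ℤ) ^ k ∣ a) (hm : m ≤ n * k) :
    padicAbsPow p n hn a ≤ (p : ℝ)⁻¹ ^ m := by
  rcases eq_or_ne a 0 with rfl | ha
  · simp only [map_zero]; positivity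
  rw [padicAbsPow_eq hn ha]
  have hk' : k ≤ padicValInt p a := ((padicValInt_dvd_iff k a).1 hk).resolve_left ha
  exact pow_le_pow_of_le_one (by positivity)
    (inv_le_one_of_one_le₀ (by exact_mod_cast hp.out.one_le))
    (hm.trans (Nat.mul_le_mul_left n hk'))

/-- If `g` is monic and the Gauss norm of `f * g` is at most `c ^ (deg f + deg g)`, then the Gauss
norm of `f` is at most `c ^ deg f`. -/
theorem gaussNorm_le_of_monic_mul {R : Type*} [Ring R] [Nontrivial R] {v : AbsoluteValue R ℝ}
    (hv : IsNonarchimedean v) {c : ℝ} (hc : 0 < c) {f g : R[X]} (hg : g.Monic)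
    (h : (f * g).gaussNorm v c ≤ c ^ (f.natDegree + g.natDegree)) :
    f.gaussNorm v c ≤ c ^ f.natDegree := by
  have h1 := g.le_gaussNorm v hc.le g.natDegree
  rw [hg.coeff_natDegree, map_one, one_mul] at h1
  rw [gaussNorm_mul hv hc, pow_add] at h
  have hpos : 0 < c ^ g.natDegree := by positivity
  refine le_of_mul_le_mul_right ((mul_le_mul_of_nonneg_left h1 ?_).trans h) hpos
  exact gaussNorm_nonneg v f hc.le

/-- The Newton polygon bound at the constant coefficient for a polynomial of small Gauss norm. -/
theorem mul_natDegree_le_of_gaussNorm_le {p : ℕ} [hp : Fact p.Prime] {n α : ℕ} (hn : n ≠ 0)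
    {f : ℤ[X]} (h0 : f.coeff 0 ≠ 0)
    (h : f.gaussNorm (padicAbsPow p n hn) ((p : ℝ)⁻¹ ^ α) ≤ ((p : ℝ)⁻¹ ^ α) ^ f.natDegree) :
    α * f.natDegree ≤ n * padicValInt p (f.coeff 0) := by
  have hp0 : 0 < (p : ℝ)⁻¹ := inv_pos.2 (by exact_mod_cast hp.out.pos)
  have h1 := (f.le_gaussNorm (padicAbsPow p n hn) (pow_pos hp0 α).le 0).trans h
  rw [pow_zero, mul_one, padicAbsPow_eq hn h0, ← pow_mul] at h1
  exact (pow_le_pow_iff_right_of_lt_one₀ hp0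
    (inv_lt_one_of_one_lt₀ (by exact_mod_cast hp.out.one_lt))).1 h1

/-- Dumas' irreducibility criterion: let `E ∈ ℤ[X]` be monic of degree `n ≥ 2`.
If there exist a prime `μ` and a positive integer `α` with `gcd(α, n) = 1` such that
`μ^α ∣ a_0`, `μ^{α+1} ∤ a_0`, and `μ^{⌈α(n−i)/n⌉} ∣ a_i` for all `1 ≤ i ≤ n−1`
(where `⌈α(n−i)/n⌉ = (α(n−i) + n − 1) / n` in natural division), then `E` is
irreducible in `ℤ[X]`. -/
theorem dumas_irreducible (n : ℕ) (hn : 2 ≤ n)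
    (E : Polynomial ℤ) (hE : E.Monic) (hdeg : E.natDegree = n)
    (μ : ℕ) (hμ : Nat.Prime μ) (α : ℕ) (hα : 0 < α)
    (hgcd : Nat.gcd α n = 1)
    (h0 : (μ : ℤ) ^ α ∣ E.coeff 0)
    (h0' : ¬ (μ : ℤ) ^ (α + 1) ∣ E.coeff 0)
    (hi : ∀ i, 1 ≤ i → i ≤ n - 1 →
      (μ : ℤ) ^ ((α * (n - i) + n - 1) / n) ∣ E.coeff i) :
    Irreducible E := by
  have : Fact μ.Prime := ⟨hμ⟩
  have hn0 : n ≠ 0 := by omega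
  have hna := isNonarchimedean_padicAbsPow μ n hn0
  set v := padicAbsPow μ n hn0
  set c : ℝ := (μ : ℝ)⁻¹ ^ α with hc
  have hc0 : 0 < c := pow_pos (inv_pos.2 (by exact_mod_cast hμ.pos)) α
  have hnorm : E.gaussNorm v c ≤ c ^ n := by
    obtain ⟨i, hEi⟩ := E.exists_eq_gaussNorm v c
    rw [hEi]
    rcases lt_trichotomy i n with hlt | rfl | hgt
    · have hle : v (E.coeff i) ≤ c ^ (n - i) := by
        rw [hc, ← pow_mul]
        rcases Nat.eq_zero_or_pos i with rfl | hpos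
        · exact padicAbsPow_le_of_dvd hn0 h0 (by simp [mul_comm])
        · refine padicAbsPow_le_of_dvd hn0 (hi i hpos (by omega)) ?_
          have h1 := Nat.div_add_mod (α * (n - i) + n - 1) n
          have h2 := Nat.mod_lt (α * (n - i) + n - 1) (Nat.pos_of_ne_zero hn0)
          omega
      calc v (E.coeff i) * c ^ i ≤ c ^ (n - i) * c ^ i := by gcongr
        _ = c ^ n := by rw [← pow_add, Nat.sub_add_cancel hlt.le]
    · rw [← hdeg, hE.coeff_natDegree, map_one, one_mul]
    · rw [coeff_eq_zero_of_natDegree_lt (hdeg ▸ hgt), map_zero, zero_mul]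
      positivity
  have hE0 : E.coeff 0 ≠ 0 := fun h => h0' (h ▸ dvd_zero _)
  have hval : padicValInt μ (E.coeff 0) = α := by
    have h1 := ((padicValInt_dvd_iff α _).1 h0).resolve_left hE0
    have h2 : ¬ α + 1 ≤ padicValInt μ (E.coeff 0) := fun h => h0' ((padicValInt_dvd_iff (α + 1) _).2 (Or.inr h))
    omega
  rw [hE.irreducible_iff_natDegree]
  refine ⟨fun h => by rw [h, natDegree_one] at hdeg; omega, fun f g hf hg hfg => ?_⟩
  have hsum : f.natDegree + g.natDegree = n := by rw [← hf.natDegree_mul hg, hfg, hdeg]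
  have hmul : f.coeff 0 * g.coeff 0 = E.coeff 0 := by rw [← mul_coeff_zero, hfg]
  have hf0 : f.coeff 0 ≠ 0 := fun h => hE0 (by rw [← hmul, h, zero_mul])
  have hg0 : g.coeff 0 ≠ 0 := fun h => hE0 (by rw [← hmul, h, mul_zero])
  have hF := mul_natDegree_le_of_gaussNorm_le hn0 hf0
    (gaussNorm_le_of_monic_mul hna hc0 hg (by rwa [hfg, hsum]))
  have hG := mul_natDegree_le_of_gaussNorm_le hn0 hg0
    (gaussNorm_le_of_monic_mul hna hc0 hf (by rwa [mul_comm g, hfg, add_comm, hsum]))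
  rw [← hmul, padicValInt.mul hf0 hg0] at hval
  have heq : α * f.natDegree = n * padicValInt μ (f.coeff 0) := by
    have h1 : α * f.natDegree + α * g.natDegree =
        n * padicValInt μ (f.coeff 0) + n * padicValInt μ (g.coeff 0) := by
      rw [← mul_add, ← mul_add, hsum, hval, mul_comm]
    omega
  have hdvd : n ∣ f.natDegree :=
    (Nat.Coprime.symm hgcd).dvd_of_dvd_mul_left ⟨_, heq⟩
  rcases Nat.eq_zero_or_pos f.natDegree with h | h
  · exact Or.inl h
  · have := Nat.le_of_dvd h hdvd
    omega
end

section
/- Let E(X) = X^n + a_kX^k + ⋯ + a_1X + a_0 ∈ ℤ[X] be monic of degree n ≥ 2 with a_i = 0 for k < i < n and a_0 ≠ 0. Let t ≥ 2, let μ_1, …, μ_t be pairwise distinct primes, and let α_1, …, α_t be positive integers with gcd(α_1, …, α_t, n) = 1. If for every j ∈ {1, …, t} and every i ∈ {0, …, k} the prime power μ_j^{α_j} divides a_i, and μ_j^{α_j+1} does not divide a_0, then E(X) is irreducible in ℤ[X]. -/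
open Polynomial

/-- If `f g` is congruent to `X ^ n` modulo `c`, where `n = deg f + deg g`, then
`c ^ deg f ∣ f(0) ^ n`. -/
theorem Polynomial.pow_natDegree_dvd_coeff_zero_pow {R : Type*} [CommRing R] {f g : R[X]}
    {c : R} (hc : C c ∣ f * g - X ^ (f.natDegree + g.natDegree)) :
    c ^ f.natDegree ∣ f.coeff 0 ^ (f.natDegree + g.natDegree) := by
  obtain ⟨h, hh⟩ := hc
  have hX : X ^ (f.natDegree + g.natDegree) = C c * -h + f * g := by
    linear_combination -hh
  have hres := resultant_X_pow_right f f.natDegree (f.natDegree + g.natDegree) le_rfl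
  rw [hX, resultant_add_mul_right _ _ _ _ _ (add_comm _ _).le le_rfl,
    resultant_C_mul_right] at hres
  have hunit : IsUnit ((-1 : R) ^ (f.natDegree * (f.natDegree + g.natDegree))) :=
    isUnit_one.neg.pow _
  rw [← hunit.dvd_mul_left, ← hres]
  exact dvd_mul_right _ _

/-- If `p` is prime, `f(0) g(0)` is not divisible by `p ^ (a + 1)`, and `f g` is congruent
to `X ^ n` modulo `p ^ a`, where `n = deg f + deg g`, then `n ∣ a * deg f`. -/
theorem Polynomial.natDegree_add_natDegree_dvd_mul_natDegree {R : Type*} [CommRing R] [IsDomain R]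
    [WfDvdMonoid R] {f g : R[X]} {p : R} {a : ℕ} (hp : Prime p)
    (hc : C (p ^ a) ∣ f * g - X ^ (f.natDegree + g.natDegree))
    (h0 : ¬ p ^ (a + 1) ∣ f.coeff 0 * g.coeff 0) :
    f.natDegree + g.natDegree ∣ a * f.natDegree := by
  have key {f g : R[X]} {v : ℕ} {u : R}
      (hc : C (p ^ a) ∣ f * g - X ^ (f.natDegree + g.natDegree))
      (hu : ¬ p ∣ u) (hv : f.coeff 0 = p ^ v * u) :
      a * f.natDegree ≤ v * (f.natDegree + g.natDegree) := by
    have h := pow_natDegree_dvd_coeff_zero_pow hc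
    rw [hv, mul_pow, ← pow_mul, ← pow_mul] at h
    exact (pow_dvd_pow_iff hp.ne_zero hp.not_isUnit).1
      (hp.pow_dvd_of_dvd_mul_right _ (fun h' ↦ hu (hp.dvd_of_dvd_pow h')) h)
  have hfg : f.coeff 0 * g.coeff 0 ≠ 0 := fun h ↦ h0 (h ▸ dvd_zero _)
  obtain ⟨v, u, hu, hv⟩ := WfDvdMonoid.max_power_factor (left_ne_zero_of_mul hfg) hp.irreducible
  obtain ⟨w, x, hx, hw⟩ := WfDvdMonoid.max_power_factor (right_ne_zero_of_mul hfg) hp.irreducible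
  have hle : v + w ≤ a := by
    by_contra! hlt
    refine h0 ((pow_dvd_pow p hlt).trans ⟨u * x, ?_⟩)
    rw [hv, hw, pow_add]
    ring
  have hfv := key hc hu hv
  have hgw := key (by rwa [mul_comm g f, add_comm g.natDegree]) hx hw
  exact ⟨v, by nlinarith⟩

/-- Bonciocat's irreducibility criterion (Corollary 1.2 of Bonciocat):
let `E = X^n + a_k X^k + ⋯ + a_1 X + a_0 ∈ ℤ[X]` be monic of degree `n ≥ 2` with
`a_i = 0` for `k < i < n` and `a_0 ≠ 0`.  Let `t ≥ 2`, let `μ_1, …, μ_t` be pairwise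
distinct primes and `α_1, …, α_t` positive integers with `gcd(α_1, …, α_t, n) = 1`.
If `μ_j^{α_j} ∣ a_i` for all `j` and all `0 ≤ i ≤ k` and `μ_j^{α_j+1} ∤ a_0` for all `j`,
then `E` is irreducible in `ℤ[X]`. -/
theorem bonciocat_irreducible (n k : ℕ) (hn : 2 ≤ n) (hk : k < n)
    (E : Polynomial ℤ) (hE : E.Monic) (hdeg : E.natDegree = n)
    (hmid : ∀ i, k < i → i < n → E.coeff i = 0)
    (h0ne : E.coeff 0 ≠ 0)
    (t : ℕ) (ht : 2 ≤ t)
    (μ : Fin t → ℕ) (hμ : ∀ j, Nat.Prime (μ j)) (hμinj : Function.Injective μ)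
    (α : Fin t → ℕ) (hα : ∀ j, 0 < α j)
    (hgcd : Nat.gcd (Finset.univ.gcd α) n = 1)
    (hdvd : ∀ j, ∀ i, i ≤ k → (μ j : ℤ) ^ (α j) ∣ E.coeff i)
    (hnotdvd : ∀ j, ¬ (μ j : ℤ) ^ (α j + 1) ∣ E.coeff 0) :
    Irreducible E := by
  have hcongr (j : Fin t) : C ((μ j : ℤ) ^ α j) ∣ E - X ^ n := by
    rw [C_dvd_iff_dvd_coeff]
    intro i
    rw [coeff_sub, coeff_X_pow]
    rcases lt_trichotomy i n with hi | rfl | hi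
    · rw [if_neg hi.ne, sub_zero]
      rcases le_or_gt i k with hik | hik
      · exact hdvd j i hik
      · simp [hmid i hik hi]
    · simp [← hdeg, hE.coeff_natDegree]
    · simp [hi.ne', coeff_eq_zero_of_natDegree_lt (hdeg ▸ hi)]
  rw [hE.irreducible_iff_natDegree]
  refine ⟨fun h ↦ by simp [h] at hdeg; lia, ?_⟩
  rintro f g hf hg rfl
  rw [hf.natDegree_mul hg] at hdeg
  subst hdeg
  have hdvd_mul (j : Fin t) : f.natDegree + g.natDegree ∣ α j * f.natDegree :=
    natDegree_add_natDegree_dvd_mul_natDegree (Nat.prime_iff_prime_int.1 (hμ j)) (hcongr j)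
      (by simpa only [mul_coeff_zero] using hnotdvd j)
  have hd : f.natDegree + g.natDegree ∣ Finset.univ.gcd α * f.natDegree := by
    have h := Finset.dvd_gcd (s := Finset.univ) fun j _ ↦ hdvd_mul j
    rwa [Finset.gcd_mul_right, normalize_eq] at h
  have hdf : f.natDegree + g.natDegree ∣ f.natDegree :=
    (Nat.Coprime.symm hgcd).dvd_of_dvd_mul_left hd
  rcases Nat.eq_zero_or_pos f.natDegree with h | h
  · exact Or.inl h
  · exact Or.inr (by have := Nat.le_of_dvd h hdf; lia)
end

section
/- Let n ≥ 2 be an integer. There exists an integer m ≥ 1 such that the m-th cyclotomic polynomial Φ_m ∈ ℤ[X] has degree n (i.e., φ(m) = n) and has coefficient 0 in every degree i with n/2 < i < n, if and only if n = 2^i·3^j for some integers i ≥ 1 and j ≥ 0. (The polynomials arising are exactly Φ_{2^{i+1}} = X^{2^i} + 1, Φ_{3^{j+1}} = X^{2·3^j} + X^{3^j} + 1, and Φ_{2^i·3^{j+1}} = X^{2^i·3^j} − X^{2^{i−1}·3^j} + 1.) -/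
open Polynomial

namespace Polynomial

/-- If every prime factor of `s` divides `n`, then `Φ_{ns}(X) = Φ_n(X^s)`. -/
theorem expand_cyclotomic_of_forall_prime_dvd (R : Type*) [CommRing R] {n s : ℕ} (hs : s ≠ 0)
    (h : ∀ p, p.Prime → p ∣ s → p ∣ n) :
    expand R s (cyclotomic n R) = cyclotomic (n * s) R := by
  induction s using induction_on_primes with
  | zero => exact absurd rfl hs
  | one => simp
  | prime_mul p a hp ih =>
    have ha := ih (right_ne_zero_of_mul hs) fun q hq hqa => h q hq (hqa.mul_left p)
    rw [← expand_expand, ha, cyclotomic_expand_eq_cyclotomic hp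
      ((h p hp (dvd_mul_right p a)).mul_right a), mul_assoc, mul_comm a p]

theorem nextCoeff_expand {R : Type*} [CommSemiring R] {p : ℕ} (hp : 1 < p) (f : R[X]) :
    (expand R p f).nextCoeff = 0 := by
  rw [nextCoeff_eq_zero, or_iff_not_imp_left]
  intro hd
  refine ⟨Nat.pos_of_ne_zero hd, ?_⟩
  rw [natDegree_expand] at hd ⊢
  rw [coeff_expand (by lia), if_neg]
  intro h
  have := (Nat.dvd_sub_iff_right (Nat.one_le_iff_ne_zero.mpr hd) (dvd_mul_left p _)).mp h
  exact hp.ne' (Nat.dvd_one.mp this)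

theorem nextCoeff_cyclotomic_of_squarefree (R : Type*) [CommRing R] {n : ℕ}
    (hn : Squarefree n) : (cyclotomic n R).nextCoeff = -(ArithmeticFunction.moebius n : R) := by
  nontriviality R
  induction n using induction_on_primes with
  | zero => exact absurd hn not_squarefree_zero
  | one => simpa using nextCoeff_X_sub_C (1 : R)
  | prime_mul p a hp ih =>
    have hpa : ¬p ∣ a := fun h => hp.ne_one <| Nat.isUnit_iff.mp (hn p (mul_dvd_mul_left p h))
    have h := congrArg nextCoeff (cyclotomic_expand_eq_cyclotomic_mul hp hpa R)
    rw [nextCoeff_expand hp.one_lt, Monic.nextCoeff_mul (cyclotomic.monic _ R) (cyclotomic.monic _ R),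
      ih (hn.of_mul_right), mul_comm a p] at h
    rw [ArithmeticFunction.isMultiplicative_moebius.map_mul_of_coprime
      ((Nat.Prime.coprime_iff_not_dvd hp).mpr hpa), ArithmeticFunction.moebius_apply_prime hp]
    push_cast
    linear_combination -h

end Polynomial

theorem Nat.exists_eq_two_pow_mul_three_pow {n : ℕ} (hn : n ≠ 0)
    (h : ∀ p, p.Prime → p ∣ n → p = 2 ∨ p = 3) : ∃ a b : ℕ, n = 2 ^ a * 3 ^ b := by
  induction n using induction_on_primes with
  | zero => exact absurd rfl hn
  | one => exact ⟨0, 0, rfl⟩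
  | prime_mul p k hp ih =>
    obtain ⟨a, b, rfl⟩ := ih (right_ne_zero_of_mul hn) fun q hq hqk => h q hq (hqk.mul_left p)
    rcases h p hp (dvd_mul_right p _) with rfl | rfl
    · exact ⟨a + 1, b, by ring⟩
    · exact ⟨a, b + 1, by ring⟩

theorem Nat.exists_squarefree_mul {m : ℕ} (hm : m ≠ 0) :
    ∃ r s : ℕ, Squarefree r ∧ s ≠ 0 ∧ m = r * s ∧ ∀ p, p.Prime → p ∣ s → p ∣ r := by
  obtain ⟨s, hs⟩ := Nat.prod_primeFactors_dvd m
  refine ⟨∏ p ∈ m.primeFactors, p, s, ?_, ?_, hs, fun p hp hps => ?_⟩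
  · refine Finset.squarefree_prod_of_pairwise_isCoprime (fun p hp q hq hpq => ?_)
      fun p hp => (Nat.prime_of_mem_primeFactors hp).squarefree
    exact Nat.coprime_iff_isRelPrime.mp <| (Nat.coprime_primes (Nat.prime_of_mem_primeFactors hp)
      (Nat.prime_of_mem_primeFactors hq)).mpr hpq
  · rintro rfl
    exact hm (hs.trans (mul_zero _))
  · exact Finset.dvd_prod_of_mem _ (Nat.mem_primeFactors.mpr ⟨hp, hs ▸ hps.mul_left _, hm⟩)

/-- Suitable cyclotomic polynomials: for an integer `n ≥ 2`, there exists `m ≥ 1` such that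
the `m`-th cyclotomic polynomial has degree `n` (i.e. `φ(m) = n`) and vanishing coefficients
in every degree `i` with `n/2 < i < n`, if and only if `n = 2^i·3^j` with `i ≥ 1`, `j ≥ 0`. -/
theorem suitable_cyclotomic_iff (n : ℕ) (hn : 2 ≤ n) :
    (∃ m : ℕ, 1 ≤ m ∧ Nat.totient m = n ∧
      ∀ i : ℕ, n < 2 * i → i < n → (Polynomial.cyclotomic m ℤ).coeff i = 0) ↔
    ∃ i j : ℕ, 1 ≤ i ∧ n = 2 ^ i * 3 ^ j := by
  constructor
  · rintro ⟨m, hm, hmn, hcoeff⟩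
    obtain ⟨r, s, hr, hs, rfl, hrs⟩ := Nat.exists_squarefree_mul (Nat.one_le_iff_ne_zero.mp hm)
    have hexp := expand_cyclotomic_of_forall_prime_dvd ℤ hs hrs
    have hdeg : r.totient * s = n := by
      simpa [natDegree_expand, natDegree_cyclotomic, hmn] using congrArg natDegree hexp
    have hr0 : 0 < r.totient := Nat.totient_pos.mpr (Nat.pos_of_ne_zero hr.ne_zero)
    have hs0 := Nat.pos_of_ne_zero hs
    have htot : r.totient ≤ 2 := by
      by_contra! h
      have hne : (cyclotomic r ℤ).nextCoeff ≠ 0 := by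
        rw [nextCoeff_cyclotomic_of_squarefree ℤ hr]
        simpa using ArithmeticFunction.moebius_ne_zero_iff_squarefree.mpr hr
      obtain ⟨k, hk⟩ := Nat.exists_eq_add_of_lt hr0
      rw [nextCoeff_of_natDegree_pos (by rwa [natDegree_cyclotomic]), natDegree_cyclotomic,
        ← coeff_expand_mul hs0, hexp] at hne
      apply hne
      rw [hk] at hdeg h ⊢
      simp only [zero_add, Nat.add_sub_cancel] at *
      apply hcoeff <;> nlinarith
    have hprime : ∀ p, p.Prime → p ∣ r → p - 1 ∣ r.totient := fun p hp hpr =>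
      Nat.totient_prime hp ▸ Nat.totient_dvd_of_dvd hpr
    obtain ⟨a, b, hab⟩ := Nat.exists_eq_two_pow_mul_three_pow hs fun p hp hps => by
      have := Nat.le_of_dvd hr0 (hprime p hp (hrs p hp hps))
      have := hp.two_le
      lia
    obtain h1 | h2 : r.totient = 1 ∨ r.totient = 2 := by lia
    · have hb : b = 0 := by
        by_contra hb
        have h3 : 3 ∣ s := hab ▸ (dvd_pow_self 3 hb).mul_left _
        have := hprime 3 Nat.prime_three (hrs 3 Nat.prime_three h3)
        simp [h1] at this
      subst hb
      refine ⟨a, 0, Nat.one_le_iff_ne_zero.mpr ?_, by rw [← hdeg, h1, one_mul, hab]⟩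
      rintro rfl
      rw [h1, hab] at hdeg
      lia
    · exact ⟨a + 1, b, by lia, by rw [← hdeg, h2, hab]; ring⟩
  · rintro ⟨i, j, hi, rfl⟩
    obtain ⟨k, rfl⟩ := Nat.exists_eq_add_of_le' hi
    have hs : 2 ^ k * 3 ^ j ≠ 0 := by positivity
    have hexp := expand_cyclotomic_of_forall_prime_dvd ℤ (n := 6) hs fun p hp hps => by
      rcases hp.dvd_mul.mp hps with h | h
      · exact (hp.dvd_of_dvd_pow h).trans (by norm_num)
      · exact (hp.dvd_of_dvd_pow h).trans (by norm_num)
    have hpow : 2 ^ (k + 1) * 3 ^ j = 2 * (2 ^ k * 3 ^ j) := by ring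
    rw [hpow]
    generalize 2 ^ k * 3 ^ j = s at hs hexp
    refine ⟨6 * s, by lia, ?_, fun i hi1 hi2 => ?_⟩
    · have h6 : Nat.totient 6 = 2 := by decide
      simpa only [natDegree_expand, natDegree_cyclotomic, h6] using
        (congrArg natDegree hexp).symm
    · rw [← hexp, cyclotomic_six]
      simp only [map_add, map_sub, map_pow, expand_X, map_one, ← pow_mul, coeff_add, coeff_sub,
        coeff_X_pow, coeff_one]
      rw [if_neg (by lia), if_neg (by lia), if_neg (by lia)]
      simp
end

section
/- Let a > b > c > 0 be integers and β, γ, δ ∈ {−1, 1}. Write gcd(a, b, c) = 2^t·m with m odd, and set a′ = a/2^t, b′ = b/2^t, c′ = c/2^t, ā = gcd(a′, b′−c′), b̄ = gcd(b′, a′−c′), c̄ = gcd(c′, a′−b′). Then the quadrinomial X^a + βX^b + γX^c + δ is irreducible in ℤ[X] if and only if one of the following holds: (1) (β, γ, δ) = (1, 1, 1) and ā·b̄·c̄ ≡ 1 (mod 2); (2) (β, γ, δ) = (−1, 1, 1), b′−c′ ≢ 0 (mod 2ā), b′ ≢ 0 (mod 2b̄), and a′−b′ ≢ 0 (mod 2c̄);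 (3) (β, γ, δ) = (1, −1, 1), b′−c′ ≢ 0 (mod 2ā), a′−c′ ≢ 0 (mod 2b̄), and c′ ≢ 0 (mod 2c̄); (4) (β, γ, δ) = (1, 1, −1), a′ ≢ 0 (mod 2ā), b′ ≢ 0 (mod 2b̄), and c′ ≢ 0 (mod 2c̄); (5) (β, γ, δ) = (−1, −1, −1), a′ ≢ 0 (mod 2ā), a′−c′ ≢ 0 (mod 2b̄), and a′−b′ ≢ 0 (mod 2c̄). -/
open Polynomial

/-- The quadrinomial `X ^ a + β X ^ b + γ X ^ c + δ`. -/
noncomputable def quadrinomial (a b c : ℕ) (β γ δ : ℤ) : ℤ[X] :=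
  X ^ a + C β * X ^ b + C γ * X ^ c + C δ

/-- The coefficient of `X ^ (a + n)`, for `n > 0`, in the product of
`quadrinomial a b c β γ δ` with its mirror. -/
def autocorrelation (a b c : ℕ) (β γ δ : ℤ) (n : ℕ) : ℤ :=
  (if n = a then δ else 0) + (if n = a - b then β else 0) + (if n = a - c then γ else 0) +
    (if n = b then β * δ else 0) + (if n = c then γ * δ else 0) + (if n = b - c then β * γ else 0)

section Quadrinomial

variable {a b c : ℕ} {β γ δ : ℤ}

lemma quadrinomial_natDegree (hab : b < a) (hbc : c < b) :
    (quadrinomial a b c β γ δ).natDegree = a := by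
  unfold quadrinomial
  compute_degree!
  all_goals grind

lemma quadrinomial_monic (hab : b < a) (hbc : c < b) :
    (quadrinomial a b c β γ δ).Monic := by
  rw [Monic, leadingCoeff, quadrinomial_natDegree hab hbc]
  simp only [quadrinomial, coeff_add, coeff_C_mul, coeff_X_pow, coeff_C]
  grind

lemma quadrinomial_coeff_zero (hab : b < a) (hbc : c < b) (hc : 0 < c) :
    (quadrinomial a b c β γ δ).coeff 0 = δ := by
  simp [quadrinomial, coeff_X_pow, hc.ne, (hc.trans hbc).ne, (hc.trans (hbc.trans hab)).ne]

lemma quadrinomial_natTrailingDegree (hab : b < a) (hbc : c < b) (hc : 0 < c) (hδ : δ ≠ 0) :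
    (quadrinomial a b c β γ δ).natTrailingDegree = 0 := by
  apply natTrailingDegree_eq_zero.2
  right
  rwa [quadrinomial_coeff_zero hab hbc hc]

lemma quadrinomial_mirror (hab : b < a) (hbc : c < b) (hc : 0 < c) (hδ : δ ≠ 0) :
    (quadrinomial a b c β γ δ).mirror =
      C δ * X ^ a + C γ * X ^ (a - c) + C β * X ^ (a - b) + 1 := by
  rw [mirror, quadrinomial_natTrailingDegree hab hbc hc hδ, reverse,
    quadrinomial_natDegree hab hbc, quadrinomial, reflect_add, reflect_add, reflect_add,
    reflect_C_mul_X_pow, reflect_C_mul_X_pow, reflect_C, ← one_mul (X ^ a), ← C_1,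
    reflect_C_mul_X_pow, revAt_le hab.le, revAt_le (hbc.trans hab).le, revAt_le le_rfl]
  simp
  ring

lemma C_mul_quadrinomial_mirror (hab : b < a) (hbc : c < b) (hc : 0 < c) (hδ : δ * δ = 1) :
    C δ * (quadrinomial a b c β γ δ).mirror =
      quadrinomial a (a - c) (a - b) (γ * δ) (β * δ) δ := by
  have hδ' : (C δ * C δ : ℤ[X]) = 1 := by rw [← C_mul, hδ, C_1]
  rw [quadrinomial_mirror hab hbc hc (by rintro rfl; simp at hδ), quadrinomial, C_mul, C_mul]
  linear_combination X ^ a * hδ'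

lemma coeff_quadrinomial_mul_mirror (hab : b < a) (hbc : c < b) (hc : 0 < c) (hδ : δ ≠ 0)
    {n : ℕ} (hn : 0 < n) :
    (quadrinomial a b c β γ δ * (quadrinomial a b c β γ δ).mirror).coeff (a + n) =
      autocorrelation a b c β γ δ n := by
  have expand : quadrinomial a b c β γ δ * (quadrinomial a b c β γ δ).mirror =
      C δ * X ^ (a + a) + C β * X ^ (a + (a - b)) + C γ * X ^ (a + (a - c)) +
      C (β * δ) * X ^ (a + b) + C (γ * δ) * X ^ (a + c) + C (β * γ) * X ^ (b + (a - c)) +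
      (X ^ a + C (β * β) * X ^ (b + (a - b)) + C β * X ^ b +
        C (γ * β) * X ^ (c + (a - b)) + C (γ * γ) * X ^ (c + (a - c)) + C γ * X ^ c +
        C (δ * δ) * X ^ a + C (δ * γ) * X ^ (a - c) + C (δ * β) * X ^ (a - b) + C δ) := by
    rw [quadrinomial_mirror hab hbc hc hδ, quadrinomial]
    simp only [C_mul, pow_add]
    ring
  rw [expand, autocorrelation]
  simp only [coeff_add, coeff_C_mul, coeff_X_pow, coeff_C]
  have e1 : (a + n = b + (a - c)) = (n = b - c) := by apply propext; omega
  have e2 : a + n ≠ b + (a - b) := by omega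
  have e3 : a + n ≠ c + (a - b) := by omega
  have e4 : a + n ≠ c + (a - c) := by omega
  have e5 : a + n ≠ b := by omega
  have e6 : a + n ≠ c := by omega
  have e7 : a + n ≠ a - c := by omega
  have e8 : a + n ≠ a - b := by omega
  simp [e1, e2, e3, e4, e5, e6, e7, e8, hn.ne']

lemma quadrinomial_sum_sq (hab : b < a) (hbc : c < b) (hc : 0 < c)
    (hβ : β = 1 ∨ β = -1) (hγ : γ = 1 ∨ γ = -1) (hδ : δ = 1 ∨ δ = -1) :
    ((quadrinomial a b c β γ δ).sum fun _ x => x ^ 2) = 4 := by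
  have hcoeff (i : ℕ) : (quadrinomial a b c β γ δ).coeff i ^ 2 =
      (if i = a then 1 else 0) + (if i = b then 1 else 0) + (if i = c then 1 else 0) +
        if i = 0 then 1 else 0 := by
    simp only [quadrinomial, coeff_add, coeff_C_mul, coeff_X_pow, coeff_C]
    grind
  rw [sum_over_range _ (by simp), quadrinomial_natDegree hab hbc]
  simp only [hcoeff, Finset.sum_add_distrib, Finset.sum_ite_eq', Finset.mem_range]
  rw [if_pos (by omega), if_pos (by omega), if_pos (by omega), if_pos (by omega)]
  norm_num

end Quadrinomial

/-- An integer polynomial whose squared coefficients sum to `4`, and whose constant coefficient does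
not vanish, is a quadrinomial up to sign. -/
lemma exists_eq_quadrinomial {k : ℤ[X]} {a : ℕ} (ha : 0 < a) (hdeg : k.natDegree = a)
    (h0 : k.coeff 0 ≠ 0) (hsq : (k.sum fun _ x => x ^ 2) = 4) :
    ∃ (d e : ℕ) (β γ δ : ℤ), d < a ∧ e < d ∧ 0 < e ∧ (β = 1 ∨ β = -1) ∧ (γ = 1 ∨ γ = -1) ∧
      (δ = 1 ∨ δ = -1) ∧ (k = quadrinomial a d e β γ δ ∨ k = -quadrinomial a d e β γ δ) := by
  have hk : k ≠ 0 := by rintro rfl; simp at h0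
  have h0S : 0 ∈ k.support := mem_support_iff.2 h0
  have haS : a ∈ k.support := hdeg ▸ natDegree_mem_support_of_nonzero hk
  rw [sum_def] at hsq
  have hone : ∀ i ∈ k.support, k.coeff i ^ 2 = 1 := by
    intro i hi
    obtain ⟨j, hj, hij⟩ : ∃ j ∈ k.support, i ≠ j := by
      by_cases hi0 : i = 0
      · exact ⟨a, haS, by omega⟩
      · exact ⟨0, h0S, hi0⟩
    have hle : ∑ l ∈ {i, j}, k.coeff l ^ 2 ≤ ∑ l ∈ k.support, k.coeff l ^ 2 :=
      Finset.sum_le_sum_of_subset_of_nonneg (by grind) fun l _ _ => sq_nonneg _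
    rw [Finset.sum_pair hij, hsq] at hle
    have hjpos : 0 < k.coeff j ^ 2 := by
      have := mem_support_iff.1 hj
      positivity
    exact Int.sq_eq_one_of_sq_le_three (by linarith) (mem_support_iff.1 hi)
  have hcard : k.support.card = 4 := by
    rw [Finset.sum_congr rfl hone] at hsq
    exact_mod_cast (by simpa using hsq : (k.support.card : ℤ) = 4)
  have hcard' : ((k.support.erase 0).erase a).card = 2 := by
    rw [Finset.card_erase_of_mem (by grind), Finset.card_erase_of_mem h0S, hcard]
  obtain ⟨d, e, hed, hS⟩ : ∃ d e, e < d ∧ (k.support.erase 0).erase a = {d, e} := by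
    obtain ⟨x, y, hxy, h⟩ := Finset.card_eq_two.1 hcard'
    rcases hxy.lt_or_gt with h' | h'
    · exact ⟨y, x, h', by rw [h, Finset.pair_comm]⟩
    · exact ⟨x, y, h', h⟩
  have hd : d ∈ (k.support.erase 0).erase a := by simp [hS]
  have he : e ∈ (k.support.erase 0).erase a := by simp [hS]
  simp only [Finset.mem_erase] at hd he
  have hda : d < a := lt_of_le_of_ne (hdeg ▸ le_natDegree_of_mem_supp d hd.2.2) hd.1
  have he0 : 0 < e := Nat.pos_of_ne_zero he.2.1
  have hsupp : k.support = {a, d, e, 0} := by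
    ext i
    have := congrArg (i ∈ ·) hS
    grind
  have hsum : k = C (k.coeff a) * X ^ a + C (k.coeff d) * X ^ d + C (k.coeff e) * X ^ e +
      C (k.coeff 0) := by
    conv_lhs => rw [k.as_sum_support_C_mul_X_pow, hsupp]
    rw [Finset.sum_insert (by simp; omega), Finset.sum_insert (by simp; omega),
      Finset.sum_pair (by omega)]
    simp [add_assoc]
  have hd1 := sq_eq_one_iff.1 (hone d hd.2.2)
  have he1 := sq_eq_one_iff.1 (hone e he.2.2)
  have h01 := sq_eq_one_iff.1 (hone 0 h0S)
  rcases sq_eq_one_iff.1 (hone a haS) with h1 | h1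
  · refine ⟨d, e, k.coeff d, k.coeff e, k.coeff 0, hda, hed, he0, hd1, he1, h01, .inl ?_⟩
    rw [h1] at hsum
    simpa [quadrinomial] using hsum
  · refine ⟨d, e, -k.coeff d, -k.coeff e, -k.coeff 0, hda, hed, he0, by omega, by omega, by omega,
      .inr ?_⟩
    rw [h1] at hsum
    rw [quadrinomial]
    conv_lhs => rw [hsum]
    simp only [C_neg, C_1]
    ring

section Autocorrelation

variable {a b c d e : ℕ} {β γ δ β' γ' : ℤ}

lemma autocorrelation_eq_of_lt_of_lt (hab : b < a) (hbc : c < b) (hc : 0 < c)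
    (hda : d < a) (hed : e < d) (he : 0 < e)
    (hβ : β = 1 ∨ β = -1) (hγ : γ = 1 ∨ γ = -1) (hδ : δ = 1 ∨ δ = -1)
    (hβ' : β' = 1 ∨ β' = -1) (hγ' : γ' = 1 ∨ γ' = -1)
    (hbca : a < b + c) (hdea : a < d + e)
    (H : ∀ n, 0 < n → autocorrelation a b c β γ δ n = autocorrelation a d e β' γ' δ n) :
    d = b ∧ e = c ∧ β' = β ∧ γ' = γ := by
  have hb := H b (by omega)
  have hd := H d (by omega)
  unfold autocorrelation at *
  have h1 : d = b ∧ β' = β := by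
    clear H
    rcases hδ with rfl | rfl <;> rcases hβ with rfl | rfl <;> rcases hβ' with rfl | rfl <;>
      grind (splits := 40)
  obtain ⟨rfl, rfl⟩ := h1
  have h1 := H (a - c) (by omega)
  have h2 := H c (by omega)
  have h3 := H (d - c) (by omega)
  have h4 := H (a - e) (by omega)
  have h5 := H e (by omega)
  have h6 := H (d - e) (by omega)
  clear H hb hd
  rcases hδ with rfl | rfl <;> rcases hβ with rfl | rfl <;> rcases hγ with rfl | rfl <;>
    rcases hγ' with rfl | rfl <;> grind (splits := 40)

lemma autocorrelation_eq_of_lt_of_eq (hab : b < a) (hbc : c < b) (hc : 0 < c)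
    (hda : d < a) (hed : e < d) (he : 0 < e)
    (hβ : β = 1 ∨ β = -1) (hγ : γ = 1 ∨ γ = -1) (hδ : δ = 1 ∨ δ = -1)
    (hβ' : β' = 1 ∨ β' = -1) (hγ' : γ' = 1 ∨ γ' = -1)
    (hbca : a < b + c) (hdea : d + e = a)
    (H : ∀ n, 0 < n → autocorrelation a b c β γ δ n = autocorrelation a d e β' γ' δ n) :
    2 * c = a ∧ 4 * b = 3 * a ∧ δ = -1 ∧ γ = -1 ∧ d - e = b ∧ β' * γ' = 1 := by
  have h0 := H d (by omega)
  have h1 := H b (by omega)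
  have h2 := H (a - c) (by omega)
  have h3 := H c (by omega)
  have h4 := H (b - c) (by omega)
  have h5 := H (a - b) (by omega)
  clear H
  unfold autocorrelation at *
  subst hdea
  rcases hδ with rfl | rfl <;> rcases hβ with rfl | rfl <;> rcases hγ with rfl | rfl <;>
    rcases hγ' with rfl | rfl <;> rcases hβ' with rfl | rfl <;> grind (splits := 40)

lemma autocorrelation_eq_of_eq_of_eq (hab : b < a) (hbc : c < b) (hc : 0 < c)
    (hda : d < a) (hed : e < d) (he : 0 < e)
    (hβ : β = 1 ∨ β = -1) (hγ : γ = 1 ∨ γ = -1) (hδ : δ = 1 ∨ δ = -1)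
    (hβ' : β' = 1 ∨ β' = -1) (hγ' : γ' = 1 ∨ γ' = -1)
    (hbca : b + c = a) (hdea : d + e = a) (hγβ : γ ≠ β * δ)
    (H : ∀ n, 0 < n → autocorrelation a b c β γ δ n = autocorrelation a d e β' γ' δ n) :
    d = b ∧ e = c ∧ (β' = β ∧ γ' = γ ∨ β' = γ * δ ∧ γ' = β * δ) := by
  have h0 := H d (by omega)
  have h1 := H (b - c) (by omega)
  clear H
  unfold autocorrelation at *
  subst hdea
  rcases hδ with rfl | rfl <;> rcases hβ with rfl | rfl <;> rcases hγ with rfl | rfl <;>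
    rcases hγ' with rfl | rfl <;> rcases hβ' with rfl | rfl <;> grind (splits := 40)

end Autocorrelation

section CommonRoots

variable {a b c : ℕ} {β γ δ : ℤ}

/-- The four terms of `quadrinomial a b c β γ δ` split into two pairs of opposite complex numbers at
some complex point. -/
def HasOppositePairs (a b c : ℕ) (β γ δ : ℤ) : Prop :=
  (∃ z : ℂ, z ^ a = (-δ : ℤ) ∧ z ^ (b - c) = (-(β * γ) : ℤ)) ∨
  (∃ z : ℂ, z ^ b = (-(β * δ) : ℤ) ∧ z ^ (a - c) = (-γ : ℤ)) ∨
  (∃ z : ℂ, z ^ c = (-(γ * δ) : ℤ) ∧ z ^ (a - b) = (-β : ℤ))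

lemma HasOppositePairs.of_mirror (hab : b < a) (hbc : c < b)
    (hδ : δ * δ = 1) (h : HasOppositePairs a (a - c) (a - b) (γ * δ) (β * δ) δ) :
    HasOppositePairs a b c β γ δ := by
  unfold HasOppositePairs at *
  rw [show a - c - (a - b) = b - c by omega, show a - (a - b) = b by omega,
    show a - (a - c) = c by omega, show γ * δ * (β * δ) = β * γ by linear_combination β * γ * hδ,
    show γ * δ * δ = γ by linear_combination γ * hδ,
    show β * δ * δ = β by linear_combination β * hδ] at h
  rcases h with h | ⟨z, h1, h2⟩ | ⟨z, h1, h2⟩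
  · exact .inl h
  · exact .inr (.inl ⟨z, h2, h1⟩)
  · exact .inr (.inr ⟨z, h2, h1⟩)

lemma aeval_quadrinomial (z : ℂ) :
    aeval z (quadrinomial a b c β γ δ) = z ^ a + β * z ^ b + γ * z ^ c + δ := by
  simp [quadrinomial]

/-- A common root of a quadrinomial and its mirror annihilates the terms in pairs. -/
lemma hasOppositePairs_of_common_root (hab : b < a) (hbc : c < b) (hc : 0 < c)
    (hβ : β * β = 1) (hγ : γ * γ = 1) (hδ : δ * δ = 1) {z : ℂ}
    (hf : aeval z (quadrinomial a b c β γ δ) = 0)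
    (hm : aeval z (quadrinomial a b c β γ δ).mirror = 0) :
    HasOppositePairs a b c β γ δ := by
  have hδ0 : δ ≠ 0 := by rintro rfl; simp at hδ
  rw [quadrinomial_mirror hab hbc hc hδ0] at hm
  rw [aeval_quadrinomial] at hf
  simp only [map_add, map_mul, aeval_C, map_pow, aeval_X, map_one, algebraMap_int_eq,
    Int.coe_castRingHom] at hm
  have hz : z ≠ 0 := by
    rintro rfl
    simp [hc.ne', (hc.trans hbc).ne', (hc.trans (hbc.trans hab)).ne', hδ0] at hf
  have hβ' : (β : ℂ) * β = 1 := by exact_mod_cast hβ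
  have hγ' : (γ : ℂ) * γ = 1 := by exact_mod_cast hγ
  have hδ' : (δ : ℂ) * δ = 1 := by exact_mod_cast hδ
  have hp : z ^ (a - b) * z ^ b = z ^ a := by rw [← pow_add]; congr 1; omega
  have hq : z ^ (a - c) * z ^ c = z ^ a := by rw [← pow_add]; congr 1; omega
  have hr : z ^ (b - c) * z ^ c = z ^ b := by rw [← pow_add]; congr 1; omega
  have hB : z ^ b ≠ 0 := pow_ne_zero _ hz
  have hC : z ^ c ≠ 0 := pow_ne_zero _ hz
  unfold HasOppositePairs
  push_cast
  generalize hA : z ^ a = A at hf hm hp hq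
  have key : (A + δ) * ((A + β * z ^ b) * (A + γ * z ^ c)) = 0 := by
    linear_combination A ^ 2 * hf + β * γ * δ * z ^ b * z ^ c * hm - β * γ * A * z ^ b * z ^ c * hδ'
      - β * δ * z ^ b * hq - β * δ * z ^ b * z ^ (a - c) * z ^ c * hγ'
      - γ * δ * z ^ c * hp - γ * δ * z ^ c * z ^ (a - b) * z ^ b * hβ'
  rcases mul_eq_zero.1 key with h | h
  · refine .inl ⟨z, by linear_combination hA + h, mul_right_cancel₀ hC ?_⟩
    linear_combination hr + β * hf - β * h - z ^ b * hβ'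
  rcases mul_eq_zero.1 h with h | h
  · refine .inr (.inr ⟨z, ?_, mul_right_cancel₀ hB ?_⟩)
    · linear_combination γ * hf - γ * h - z ^ c * hγ'
    · linear_combination hp + h
  · refine .inr (.inl ⟨z, ?_, mul_right_cancel₀ hC ?_⟩)
    · linear_combination β * hf - β * h - z ^ b * hβ'
    · linear_combination hq + h

lemma HasOppositePairs.not_irreducible (hab : b < a) (hbc : c < b) (hc : 0 < c)
    (hβ : β * β = 1) (hγ : γ * γ = 1) (h : HasOppositePairs a b c β γ δ) :
    ¬ Irreducible (quadrinomial a b c β γ δ) := by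
  intro hirr
  obtain ⟨z, n, s, hn0, hna, hzn, hz⟩ : ∃ (z : ℂ) (n : ℕ) (s : ℤ), 0 < n ∧ n < a ∧ z ^ n = s ∧
      aeval z (quadrinomial a b c β γ δ) = 0 := by
    have hβ' : (β : ℂ) * β = 1 := by exact_mod_cast hβ
    have hγ' : (γ : ℂ) * γ = 1 := by exact_mod_cast hγ
    simp only [aeval_quadrinomial]
    rcases h with ⟨z, h1, h2⟩ | ⟨z, h1, h2⟩ | ⟨z, h1, h2⟩
    · refine ⟨z, b - c, _, by omega, by omega, h2, ?_⟩
      rw [← Nat.sub_add_cancel hbc.le, pow_add, h1, h2]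
      push_cast
      linear_combination -γ * z ^ c * hβ'
    · refine ⟨z, a - c, _, by omega, by omega, h2, ?_⟩
      rw [← Nat.sub_add_cancel (hbc.trans hab).le, pow_add, h1, h2]
      push_cast
      linear_combination -δ * hβ'
    · refine ⟨z, a - b, _, by omega, by omega, h2, ?_⟩
      rw [← Nat.sub_add_cancel hab.le, pow_add, h1, h2]
      push_cast
      linear_combination -δ * hγ'
  have hmonic := quadrinomial_monic (β := β) (γ := γ) (δ := δ) hab hbc
  have hint : IsIntegral ℤ z := ⟨_, hmonic, by rwa [← aeval_def]⟩
  have hassoc : Associated (quadrinomial a b c β γ δ) (minpoly ℤ z) :=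
    ((minpoly.irreducible hint).associated_of_dvd hirr
      (minpoly.isIntegrallyClosed_dvd hint hz)).symm
  have hdvd : quadrinomial a b c β γ δ ∣ X ^ n - C s :=
    hassoc.dvd.trans (minpoly.isIntegrallyClosed_dvd hint (by simp [hzn]))
  have hle := natDegree_le_of_dvd hdvd (X_pow_sub_C_ne_zero hn0 s)
  rw [quadrinomial_natDegree hab hbc, natDegree_X_pow_sub_C] at hle
  omega

end CommonRoots

/-- Prescribing signs for two powers of `z` whose exponents are coprime up to a common factor is
possible iff the evident compatibility condition holds. -/
lemma exists_pow_eq_sign_and_pow_eq_sign_iff {m x y : ℕ} (hm : 0 < m) (hxy : x.Coprime y) {s t : ℤ}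
    (hs : s = 1 ∨ s = -1) (ht : t = 1 ∨ t = -1) :
    (∃ z : ℂ, z ^ (m * x) = s ∧ z ^ (m * y) = t) ↔ s ^ y = t ^ x := by
  constructor
  · rintro ⟨z, h1, h2⟩
    have : (s : ℂ) ^ y = (t : ℂ) ^ x := by
      rw [← h1, ← h2, ← pow_mul, ← pow_mul, mul_right_comm]
    exact_mod_cast this
  · intro h
    suffices hu : ∃ u : ℤ, u ^ x = s ∧ u ^ y = t by
      obtain ⟨u, rfl, rfl⟩ := hu
      obtain ⟨z, hz⟩ := IsAlgClosed.exists_pow_nat_eq (u : ℂ) hm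
      exact ⟨z, by simp [pow_mul, hz], by simp [pow_mul, hz]⟩
    have sign_pow_odd {r : ℤ} {n : ℕ} (hr : r = 1 ∨ r = -1) (hn : Odd n) : r ^ n = r := by
      rcases hr with rfl | rfl
      · simp
      · exact hn.neg_one_pow
    rcases Nat.even_or_odd x with hx | hx
    · have hy : Odd y := by
        rw [← Nat.not_even_iff_odd]
        exact fun hy => Nat.not_coprime_of_dvd_of_dvd one_lt_two hx.two_dvd hy.two_dvd hxy
      exact ⟨t, by rw [← h, sign_pow_odd hs hy], sign_pow_odd ht hy⟩
    · exact ⟨s, sign_pow_odd hs hx, by rw [h, sign_pow_odd ht hx]⟩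

section Irreducible

variable {a b c d e : ℕ} {β γ δ β' γ' : ℤ}

lemma autocorrelation_eq_cases (hab : b < a) (hbc : c < b) (hc : 0 < c)
    (hda : d < a) (hed : e < d) (he : 0 < e)
    (hβ : β = 1 ∨ β = -1) (hγ : γ = 1 ∨ γ = -1) (hδ : δ = 1 ∨ δ = -1)
    (hβ' : β' = 1 ∨ β' = -1) (hγ' : γ' = 1 ∨ γ' = -1)
    (hbca : a ≤ b + c) (hdea : a ≤ d + e) (hnp : ¬ HasOppositePairs a b c β γ δ)
    (H : ∀ n, 0 < n → autocorrelation a b c β γ δ n = autocorrelation a d e β' γ' δ n) :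
    (d = b ∧ e = c ∧ β' = β ∧ γ' = γ) ∨
      (d = a - c ∧ e = a - b ∧ β' = γ * δ ∧ γ' = β * δ) := by
  rcases hbca.eq_or_lt with h1 | h1 <;> rcases hdea.eq_or_lt with h2 | h2
  · have hγβ : γ ≠ β * δ := by
      rintro rfl
      obtain ⟨z, hz⟩ := IsAlgClosed.exists_pow_nat_eq ((-(β * δ) : ℤ) : ℂ) (hc.trans hbc)
      exact hnp (.inr (.inl ⟨z, hz, by rwa [show a - c = b by omega]⟩))
    have := autocorrelation_eq_of_eq_of_eq hab hbc hc hda hed he hβ hγ hδ hβ' hγ' h1.symm h2.symm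
      hγβ H
    grind
  · obtain ⟨h3, h4, rfl, -, h5, h6⟩ := autocorrelation_eq_of_lt_of_eq hda hed he hab hbc hc
      hβ' hγ' hδ hβ hγ h2 h1.symm fun n hn => (H n hn).symm
    refine (hnp (.inl ?_)).elim
    obtain ⟨z, hz⟩ := IsAlgClosed.exists_pow_nat_eq Complex.I hc
    refine ⟨z, ?_, ?_⟩
    · rw [show a = c * 8 by omega, pow_mul, hz, show 8 = 4 * 2 from rfl, pow_mul]
      simp
    · rw [show b - c = c * 6 by omega, pow_mul, hz, show 6 = 4 + 2 from rfl, pow_add, h6]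
      simp
  · obtain ⟨h3, h4, rfl, rfl, -, -⟩ := autocorrelation_eq_of_lt_of_eq hab hbc hc hda hed he
      hβ hγ hδ hβ' hγ' h1 h2.symm H
    refine (hnp (.inl ?_)).elim
    obtain ⟨z, hz⟩ := IsAlgClosed.exists_pow_nat_eq (β : ℂ) (show 0 < b - c by omega)
    refine ⟨z, ?_, ?_⟩
    · rw [show a = (b - c) * 4 by omega, pow_mul, hz]
      rcases hβ with rfl | rfl <;> norm_num
    · rw [hz]
      simp
  · exact .inl (autocorrelation_eq_of_lt_of_lt hab hbc hc hda hed he hβ hγ hδ hβ' hγ' h1 h2 H)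

/-- `k` agrees with `f` up to sign and mirroring. -/
def EqUpToMirror (f k : ℤ[X]) : Prop := k = f ∨ k = -f ∨ k = f.mirror ∨ k = -f.mirror

lemma eqUpToMirror_mirror_left {f k : ℤ[X]} : EqUpToMirror f.mirror k ↔ EqUpToMirror f k := by
  simp only [EqUpToMirror, mirror_mirror]
  tauto

lemma eqUpToMirror_mirror_right {f k : ℤ[X]} : EqUpToMirror f k.mirror ↔ EqUpToMirror f k := by
  have h (g : ℤ[X]) : k.mirror = -g ↔ k = -g.mirror := by rw [mirror_eq_iff, mirror_neg]
  simp only [EqUpToMirror, h, mirror_eq_iff, mirror_mirror]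
  tauto

lemma eqUpToMirror_neg_left {f k : ℤ[X]} : EqUpToMirror (-f) k ↔ EqUpToMirror f k := by
  simp only [EqUpToMirror, mirror_neg, neg_neg]
  tauto

lemma eqUpToMirror_neg_right {f k : ℤ[X]} : EqUpToMirror f (-k) ↔ EqUpToMirror f k := by
  simp only [EqUpToMirror, neg_eq_iff_eq_neg, neg_neg]
  tauto

/-- Replacing a quadrinomial by its mirror, one may assume `a ≤ b + c`. -/
lemma exists_quadrinomial_le_add (hab : b < a) (hbc : c < b) (hc : 0 < c)
    (hβ : β = 1 ∨ β = -1) (hγ : γ = 1 ∨ γ = -1) (hδ : δ = 1 ∨ δ = -1) :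
    ∃ (d e : ℕ) (β' γ' : ℤ), d < a ∧ e < d ∧ 0 < e ∧ (β' = 1 ∨ β' = -1) ∧ (γ' = 1 ∨ γ' = -1) ∧
      a ≤ d + e ∧ (HasOppositePairs a d e β' γ' δ → HasOppositePairs a b c β γ δ) ∧
      (quadrinomial a d e β' γ' δ * (quadrinomial a d e β' γ' δ).mirror =
        quadrinomial a b c β γ δ * (quadrinomial a b c β γ δ).mirror) ∧
      (∀ k, EqUpToMirror (quadrinomial a d e β' γ' δ) k ↔
        EqUpToMirror (quadrinomial a b c β γ δ) k) ∧
      (∀ k, EqUpToMirror k (quadrinomial a d e β' γ' δ) ↔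
        EqUpToMirror k (quadrinomial a b c β γ δ)) := by
  rcases le_or_gt a (b + c) with h | h
  · exact ⟨b, c, β, γ, hab, hbc, hc, hβ, hγ, h, id, rfl, fun _ => .rfl, fun _ => .rfl⟩
  · have hsq {r : ℤ} (hr : r = 1 ∨ r = -1) : r * r = 1 := by rcases hr with rfl | rfl <;> rfl
    have hmirror := C_mul_quadrinomial_mirror (β := β) (γ := γ) hab hbc hc (hsq hδ)
    refine ⟨a - c, a - b, γ * δ, β * δ, by omega, by omega, by omega, by grind, by grind, by omega,
      .of_mirror hab hbc (hsq hδ), ?_⟩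
    rw [← hmirror]
    rcases hδ with rfl | rfl
    · simp [mirror_mirror, mul_comm, eqUpToMirror_mirror_left, eqUpToMirror_mirror_right]
    · simp [mirror_mirror, mirror_neg, mul_comm, eqUpToMirror_mirror_left,
        eqUpToMirror_mirror_right, eqUpToMirror_neg_left, eqUpToMirror_neg_right]

/-- A quadrinomial without opposite pairs is determined, up to sign and mirroring, by its product
with its mirror. -/
lemma eqUpToMirror_of_mul_mirror_eq (hab : b < a) (hbc : c < b) (hc : 0 < c)
    (hβ : β = 1 ∨ β = -1) (hγ : γ = 1 ∨ γ = -1) (hδ : δ = 1 ∨ δ = -1)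
    (hnp : ¬ HasOppositePairs a b c β γ δ) {k : ℤ[X]}
    (hk : quadrinomial a b c β γ δ * (quadrinomial a b c β γ δ).mirror = k * k.mirror) :
    EqUpToMirror (quadrinomial a b c β γ δ) k := by
  have ne_zero {r : ℤ} (hr : r = 1 ∨ r = -1) : r ≠ 0 := by rcases hr with rfl | rfl <;> decide
  obtain ⟨d, e, β', γ', δ', hda, hed, he, hβ', hγ', hδ', hkq⟩ : ∃ (d e : ℕ) (β' γ' δ' : ℤ),
      d < a ∧ e < d ∧ 0 < e ∧ (β' = 1 ∨ β' = -1) ∧ (γ' = 1 ∨ γ' = -1) ∧ (δ' = 1 ∨ δ' = -1) ∧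
      (k = quadrinomial a d e β' γ' δ' ∨ k = -quadrinomial a d e β' γ' δ') := by
    have hdeg : k.natDegree = a := by
      have := congrArg natDegree hk
      rw [natDegree_mul_mirror, natDegree_mul_mirror, quadrinomial_natDegree hab hbc] at this
      omega
    have htrail : k.natTrailingDegree = 0 := by
      have := congrArg natTrailingDegree hk
      rw [natTrailingDegree_mul_mirror, natTrailingDegree_mul_mirror,
        quadrinomial_natTrailingDegree hab hbc hc (ne_zero hδ)] at this
      omega
    refine exists_eq_quadrinomial (by omega) hdeg ?_ ?_
    · rcases natTrailingDegree_eq_zero.1 htrail with rfl | h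
      · simp at hdeg
        omega
      · exact h
    · have hf := coeff_mul_mirror (quadrinomial a b c β γ δ)
      have hk' := coeff_mul_mirror k
      rw [quadrinomial_natDegree hab hbc, quadrinomial_natTrailingDegree hab hbc hc (ne_zero hδ),
        quadrinomial_sum_sq hab hbc hc hβ hγ hδ] at hf
      rw [hdeg, htrail] at hk'
      rw [← hk', ← hf, hk]
  wlog hkq' : k = quadrinomial a d e β' γ' δ' generalizing k
  · rw [← eqUpToMirror_neg_right]
    have h := hkq.resolve_left hkq'
    refine this ?_ ?_ ?_
    · rw [mirror_neg, neg_mul_neg, hk]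
    · simp [h]
    · simp [h]
  subst hkq'
  have coeff_eq (n : ℕ) (hn : 0 < n) :
      autocorrelation a b c β γ δ n = autocorrelation a d e β' γ' δ' n := by
    rw [← coeff_quadrinomial_mul_mirror hab hbc hc (ne_zero hδ) hn, hk,
      coeff_quadrinomial_mul_mirror hda hed he (ne_zero hδ') hn]
  obtain rfl : δ' = δ := by
    have := coeff_eq a (by omega)
    unfold autocorrelation at this
    clear hkq hk coeff_eq
    grind (splits := 40)
  obtain ⟨d₁, e₁, β₁, γ₁, hd₁, hed₁, he₁, hβ₁, hγ₁, hle₁, -, hmul₁, -, hiff₁⟩ :=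
    exists_quadrinomial_le_add hda hed he hβ' hγ' hδ
  obtain ⟨b₁, c₁, β₂, γ₂, hb₁, hbc₁, hc₁, hβ₂, hγ₂, hle₂, hpairs, hmul₂, hiff₂, -⟩ :=
    exists_quadrinomial_le_add hab hbc hc hβ hγ hδ
  rw [← hiff₁, ← hiff₂]
  have H (n : ℕ) (hn : 0 < n) :
      autocorrelation a b₁ c₁ β₂ γ₂ δ' n = autocorrelation a d₁ e₁ β₁ γ₁ δ' n := by
    rw [← coeff_quadrinomial_mul_mirror hb₁ hbc₁ hc₁ (ne_zero hδ) hn, hmul₂, hk, ← hmul₁,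
      coeff_quadrinomial_mul_mirror hd₁ hed₁ he₁ (ne_zero hδ) hn]
  rcases autocorrelation_eq_cases hb₁ hbc₁ hc₁ hd₁ hed₁ he₁ hβ₂ hγ₂ hδ hβ₁ hγ₁ hle₂ hle₁
    (mt hpairs hnp) H with ⟨rfl, rfl, rfl, rfl⟩ | ⟨rfl, rfl, rfl, rfl⟩
  · exact .inl rfl
  · rw [← C_mul_quadrinomial_mirror hb₁ hbc₁ hc₁ (by rcases hδ with rfl | rfl <;> rfl)]
    rcases hδ with rfl | rfl <;> simp [EqUpToMirror]

theorem irreducible_quadrinomial_iff (hab : b < a) (hbc : c < b) (hc : 0 < c)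
    (hβ : β = 1 ∨ β = -1) (hγ : γ = 1 ∨ γ = -1) (hδ : δ = 1 ∨ δ = -1) :
    Irreducible (quadrinomial a b c β γ δ) ↔ ¬ HasOppositePairs a b c β γ δ := by
  have hsq {r : ℤ} (hr : r = 1 ∨ r = -1) : r * r = 1 := by rcases hr with rfl | rfl <;> rfl
  have hmonic := quadrinomial_monic (β := β) (γ := γ) (δ := δ) hab hbc
  refine ⟨fun h hp => hp.not_irreducible hab hbc hc (hsq hβ) (hsq hγ) h, fun hnp => ?_⟩
  refine irreducible_of_mirror (fun hu => ?_)
    (fun k hk => eqUpToMirror_of_mul_mirror_eq hab hbc hc hβ hγ hδ hnp hk) fun g hg hg' => ?_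
  · have := natDegree_eq_zero_of_isUnit hu
    rw [quadrinomial_natDegree hab hbc] at this
    omega
  · by_contra hu
    obtain ⟨z, hz⟩ := IsAlgClosed.exists_aeval_eq_zero ℂ g
      (degree_pos_of_not_isUnit_of_dvd_monic hmonic hu hg).ne'
    exact hnp (hasOppositePairs_of_common_root hab hbc hc (hsq hβ) (hsq hγ) (hsq hδ)
      (aeval_eq_zero_of_dvd_aeval_eq_zero hg hz) (aeval_eq_zero_of_dvd_aeval_eq_zero hg' hz))

end Irreducible

/-- The two sign equations `z ^ p = s` and `z ^ q = t`, with exponents scaled by `m`, are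
simultaneously solvable unless `p`, `q` have the wrong parities after division by `p.gcd q`. -/
lemma exists_pow_eq_sign_iff_of_gcd {m p q : ℕ} (hm : 0 < m) (hp : 0 < p) {s t : ℤ}
    (hs : s = 1 ∨ s = -1) (ht : t = 1 ∨ t = -1) :
    (∃ z : ℂ, z ^ (m * p) = s ∧ z ^ (m * q) = t) ↔
      (s = -1 → t = 1 → 2 * p.gcd q ∣ q) ∧ (s = 1 → t = -1 → 2 * p.gcd q ∣ p) ∧
        (s = -1 → t = -1 → ¬ 2 * p.gcd q ∣ p ∧ ¬ 2 * p.gcd q ∣ q) := by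
  have hg : 0 < p.gcd q := Nat.gcd_pos_of_pos_left q hp
  obtain ⟨x, y, hxy, hx, hy⟩ := Nat.exists_coprime p q
  generalize p.gcd q = g at *
  subst hx hy
  have hdvd (n : ℕ) : 2 * g ∣ n * g ↔ Even n := by
    rw [Nat.mul_dvd_mul_iff_right hg, even_iff_two_dvd]
  have hpow (n : ℕ) : m * (n * g) = m * g * n := by ring
  rw [hpow, hpow, exists_pow_eq_sign_and_pow_eq_sign_iff (Nat.mul_pos hm hg) hxy hs ht, hdvd, hdvd]
  have hone (n : ℕ) : (-1 : ℤ) ^ n = 1 ↔ Even n := neg_one_pow_eq_one_iff_even (by decide)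
  have hnot : ¬ (Even x ∧ Even y) := fun h =>
    Nat.not_coprime_of_dvd_of_dvd one_lt_two h.1.two_dvd h.2.two_dvd hxy
  rcases hs with rfl | rfl <;> rcases ht with rfl | rfl
  · simp
  · simp [← hone, eq_comm]
  · simp [hone]
  · rcases Nat.even_or_odd x with h1 | h1 <;> rcases Nat.even_or_odd y with h2 | h2 <;>
      simp_all [h1.neg_one_pow, h2.neg_one_pow]

lemma two_mul_gcd_dvd_iff_of_odd {p q n : ℕ} (h : Odd (p.gcd q)) (hn : p.gcd q ∣ n) :
    2 * p.gcd q ∣ n ↔ Even n := by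
  rw [even_iff_two_dvd]
  exact ⟨dvd_of_mul_right_dvd, fun h2 =>
    (Nat.coprime_two_left.2 h).mul_dvd_of_dvd_of_dvd h2 hn⟩

/-- None of the three pairs has both entries odd after division by its greatest common divisor iff
all three greatest common divisors are odd. -/
lemma odd_gcd_mul_gcd_mul_gcd_iff {a b c : ℕ} (hab : b < a) (hbc : c < b)
    (h : ¬ (Even a ∧ Even b ∧ Even c)) :
    Odd (a.gcd (b - c) * b.gcd (a - c) * c.gcd (a - b)) ↔
      ¬ (¬ 2 * a.gcd (b - c) ∣ a ∧ ¬ 2 * a.gcd (b - c) ∣ b - c) ∧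
      ¬ (¬ 2 * b.gcd (a - c) ∣ b ∧ ¬ 2 * b.gcd (a - c) ∣ a - c) ∧
      ¬ (¬ 2 * c.gcd (a - b) ∣ c ∧ ¬ 2 * c.gcd (a - b) ∣ a - b) := by
  have hodd (p q : ℕ) : Odd (p.gcd q) ↔ ¬ (Even p ∧ Even q) := by
    rw [← Nat.not_even_iff_odd, even_iff_two_dvd, even_iff_two_dvd, even_iff_two_dvd,
      Nat.dvd_gcd_iff]
  have hdvd (p q : ℕ) (hpq : ¬ (Even p ∧ Even q)) :
      (2 * p.gcd q ∣ p ↔ Even p) ∧ (2 * p.gcd q ∣ q ↔ Even q) :=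
    ⟨two_mul_gcd_dvd_iff_of_odd ((hodd p q).2 hpq) (Nat.gcd_dvd_left p q),
      two_mul_gcd_dvd_iff_of_odd ((hodd p q).2 hpq) (Nat.gcd_dvd_right p q)⟩
  have h1 := hdvd a (b - c)
  have h2 := hdvd b (a - c)
  have h3 := hdvd c (a - b)
  rw [Nat.odd_mul, Nat.odd_mul, hodd, hodd, hodd]
  simp only [Nat.even_sub hbc.le, Nat.even_sub (hbc.trans hab).le, Nat.even_sub hab.le]
    at h1 h2 h3 ⊢
  clear hodd hdvd
  by_cases ha : Even a <;> by_cases hb : Even b <;> by_cases hc : Even c <;> grind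

/-- Finch–Jones criterion for `{−1,1}`-quadrinomials: let `a > b > c > 0`,
`β, γ, δ ∈ {−1, 1}`, write `gcd(a,b,c) = 2^t·m` with `m` odd, `a′ = a/2^t`, `b′ = b/2^t`,
`c′ = c/2^t`, `ā = gcd(a′, b′−c′)`, `b̄ = gcd(b′, a′−c′)`, `c̄ = gcd(c′, a′−b′)`.
Then `X^a + βX^b + γX^c + δ` is irreducible in `ℤ[X]` iff one of the five listed
sign/congruence conditions holds. -/
theorem finch_jones_quadrinomial (a b c : ℕ) (hab : b < a) (hbc : c < b) (hc : 0 < c)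
    (β γ δ : ℤ) (hβ : β = 1 ∨ β = -1) (hγ : γ = 1 ∨ γ = -1) (hδ : δ = 1 ∨ δ = -1)
    (t m : ℕ) (hm : Odd m) (hgcd : Nat.gcd (Nat.gcd a b) c = 2 ^ t * m)
    (a' b' c' : ℕ) (ha' : a = 2 ^ t * a') (hb' : b = 2 ^ t * b') (hc' : c = 2 ^ t * c')
    (abar bbar cbar : ℕ)
    (habar : abar = Nat.gcd a' (b' - c'))
    (hbbar : bbar = Nat.gcd b' (a' - c'))
    (hcbar : cbar = Nat.gcd c' (a' - b')) :
    Irreducible (X ^ a + C β * X ^ b + C γ * X ^ c + C δ : Polynomial ℤ) ↔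
    ( (β = 1 ∧ γ = 1 ∧ δ = 1 ∧ Odd (abar * bbar * cbar))
    ∨ (β = -1 ∧ γ = 1 ∧ δ = 1 ∧
        ¬ (2 * abar ∣ (b' - c')) ∧ ¬ (2 * bbar ∣ b') ∧ ¬ (2 * cbar ∣ (a' - b')))
    ∨ (β = 1 ∧ γ = -1 ∧ δ = 1 ∧
        ¬ (2 * abar ∣ (b' - c')) ∧ ¬ (2 * bbar ∣ (a' - c')) ∧ ¬ (2 * cbar ∣ c'))
    ∨ (β = 1 ∧ γ = 1 ∧ δ = -1 ∧
        ¬ (2 * abar ∣ a') ∧ ¬ (2 * bbar ∣ b') ∧ ¬ (2 * cbar ∣ c'))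
    ∨ (β = -1 ∧ γ = -1 ∧ δ = -1 ∧
        ¬ (2 * abar ∣ a') ∧ ¬ (2 * bbar ∣ (a' - c')) ∧ ¬ (2 * cbar ∣ (a' - b'))) ) := by
  have hpow : 0 < 2 ^ t := by positivity
  have hab' : b' < a' := by subst ha' hb'; exact lt_of_mul_lt_mul_left' hab
  have hbc' : c' < b' := by subst hc' hb'; exact lt_of_mul_lt_mul_left' hbc
  have h0c' : 0 < c' := by subst hc'; exact Nat.pos_of_mul_pos_left hc
  have hpar : ¬ (Even a' ∧ Even b' ∧ Even c') := by
    rintro ⟨h1, h2, h3⟩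
    rw [ha', hb', hc', Nat.gcd_mul_left, Nat.gcd_mul_left] at hgcd
    rw [← Nat.eq_of_mul_eq_mul_left hpow hgcd] at hm
    exact Nat.not_even_iff_odd.2 hm (even_iff_two_dvd.2
      (Nat.dvd_gcd (Nat.dvd_gcd h1.two_dvd h2.two_dvd) h3.two_dvd))
  have hneg {r : ℤ} (hr : r = 1 ∨ r = -1) : -r = 1 ∨ -r = -1 := by omega
  have hmul {r s : ℤ} (hr : r = 1 ∨ r = -1) (hs : s = 1 ∨ s = -1) : r * s = 1 ∨ r * s = -1 := by
    rcases hr with rfl | rfl <;> rcases hs with rfl | rfl <;> simp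
  refine (irreducible_quadrinomial_iff hab hbc hc hβ hγ hδ).trans ?_
  unfold HasOppositePairs
  subst ha' hb' hc' habar hbbar hcbar
  rw [← Nat.mul_sub, ← Nat.mul_sub, ← Nat.mul_sub,
    exists_pow_eq_sign_iff_of_gcd hpow (by omega) (hneg hδ) (hneg (hmul hβ hγ)),
    exists_pow_eq_sign_iff_of_gcd hpow (by omega) (hneg (hmul hβ hδ)) (hneg hγ),
    exists_pow_eq_sign_iff_of_gcd hpow h0c' (hneg (hmul hγ hδ)) (hneg hβ),
    odd_gcd_mul_gcd_mul_gcd_iff hab' hbc' hpar]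
  rcases hβ with rfl | rfl <;> rcases hγ with rfl | rfl <;> rcases hδ with rfl | rfl <;> simp
end

section
/- Let n and m be integers with n > 2m > 0 and let β, δ ∈ {−1, 1}. Write d = gcd(n, m), n₁ = n/d, m₁ = m/d. If n₁ + m₁ ≢ 0 (mod 3), then the trinomial X^n + βX^m + δ is irreducible in ℤ[X]. -/
open Polynomial

/-- At a common root `z` of `X^n + βX^m + δ` and its reciprocal polynomial, `z^n` is determined by
`z^m`, and `z^m` is a root of `X^2 + βδX + 1`. -/
theorem pow_relations_of_common_root {n m : ℕ} (hnm : m < n) {β δ : ℤ}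
    (hβ : β = 1 ∨ β = -1) (hδ : δ = 1 ∨ δ = -1) {z : ℂ}
    (h₁ : z ^ n + β * z ^ m + δ = 0) (h₂ : 1 + β * z ^ (n - m) + δ * z ^ n = 0) :
    z ^ n = δ * (z ^ m) ^ 2 ∧ (z ^ m) ^ 2 + β * δ * z ^ m + 1 = 0 := by
  have hn : z ^ n = z ^ (n - m) * z ^ m := by rw [← pow_add, Nat.sub_add_cancel hnm.le]
  have hb : (β : ℂ) ^ 2 = 1 := by rcases hβ with rfl | rfl <;> norm_num
  have hd : (δ : ℂ) ^ 2 = 1 := by rcases hδ with rfl | rfl <;> norm_num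
  have h : z ^ (n - m) = δ * z ^ m := by grind
  have h' : z ^ n = δ * (z ^ m) ^ 2 := by rw [hn, h]; ring
  exact ⟨h', by grind⟩

/-- The trinomial `X^n + βX^m + δ` and its reciprocal polynomial have no common complex root
when `n = da`, `m = db` with `a`, `b` coprime and `a + b` not divisible by `3`. -/
theorem not_common_root_of_not_three_dvd {d a b : ℕ} (hab : a.Coprime b) (hlt : d * b < d * a)
    {β δ : ℤ} (hβ : β = 1 ∨ β = -1) (hδ : δ = 1 ∨ δ = -1) (h3 : ¬ 3 ∣ a + b) {z : ℂ}
    (h₁ : z ^ (d * a) + β * z ^ (d * b) + δ = 0) :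
    1 + β * z ^ (d * a - d * b) + δ * z ^ (d * a) ≠ 0 := by
  intro h₂
  obtain ⟨hn, hm⟩ := pow_relations_of_common_root hlt hβ hδ h₁ h₂
  have hb : (β : ℂ) ^ 2 = 1 := by rcases hβ with rfl | rfl <;> norm_num
  have hd : (δ : ℂ) ^ 2 = 1 := by rcases hδ with rfl | rfl <;> norm_num
  set w := z ^ (d * b) with hw
  have hw6 : w ^ 6 = 1 := by grind
  set u := z ^ (2 * d) with hu
  have hub : u ^ b = w ^ 2 := by rw [hu, hw]; ring
  have hua : u ^ a = w ^ 4 := by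
    have : u ^ a = (z ^ (d * a)) ^ 2 := by rw [hu]; ring
    rw [this, hn, mul_pow, hd]; ring
  have hu3 : u ^ 3 = 1 := by
    rw [← orderOf_dvd_iff_pow_eq_one]
    have ha : orderOf u ∣ 3 * a := by
      rw [orderOf_dvd_iff_pow_eq_one, mul_comm, pow_mul, hua]
      linear_combination (w ^ 6 + 1) * hw6
    have hb : orderOf u ∣ 3 * b := by
      rw [orderOf_dvd_iff_pow_eq_one, mul_comm, pow_mul, hub]
      linear_combination hw6
    simpa [Nat.gcd_mul_left, hab.gcd_eq_one] using Nat.dvd_gcd ha hb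
  have hsum : u ^ (a + b) = 1 := by rw [pow_add, hua, hub, ← hw6]; ring
  have hu1 : u = 1 := by
    rw [← orderOf_eq_one_iff, ← Nat.dvd_one,
      ← ((Nat.Prime.coprime_iff_not_dvd Nat.prime_three).2 h3).gcd_eq_one]
    exact Nat.dvd_gcd (orderOf_dvd_of_pow_eq_one hu3) (orderOf_dvd_of_pow_eq_one hsum)
  have hw2 : w ^ 2 = 1 := by rw [← hub, hu1, one_pow]
  have hbd : ((β : ℂ) * δ) ^ 2 = 1 := by rw [mul_pow, hb, hd, one_mul]
  have : (3 : ℂ) = 0 := by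
    have h : (β : ℂ) * δ * w = -2 := by linear_combination hm - hw2
    have h4 : ((β : ℂ) * δ * w) ^ 2 = 1 := by rw [mul_pow, hbd, hw2, one_mul]
    rw [h] at h4
    linear_combination h4
  norm_num at this

/-- Irreducibility of `{−1,1}`-trinomials: let `n > 2m > 0`, `β, δ ∈ {−1, 1}`,
`d = gcd(n, m)`, `n₁ = n/d`, `m₁ = m/d`.  If `n₁ + m₁ ≢ 0 (mod 3)`, then
`X^n + βX^m + δ` is irreducible in `ℤ[X]`. -/
theorem trinomial_irreducible (n m : ℕ) (hm : 0 < m) (hnm : 2 * m < n)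
    (β δ : ℤ) (hβ : β = 1 ∨ β = -1) (hδ : δ = 1 ∨ δ = -1)
    (d n₁ m₁ : ℕ) (hd : d = Nat.gcd n m) (hn₁ : n = d * n₁) (hm₁ : m = d * m₁)
    (h3 : ¬ (3 ∣ (n₁ + m₁))) :
    Irreducible (X ^ n + C β * X ^ m + C δ : Polynomial ℤ) := by
  have hlt : m < n := by omega
  have hcop : n₁.Coprime m₁ := by
    have hd0 : 0 < d := hd ▸ Nat.gcd_pos_of_pos_right n hm
    rw [hn₁, hm₁, Nat.gcd_mul_left] at hd
    exact Nat.eq_of_mul_eq_mul_left hd0 (by rw [← hd, mul_one])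
  have hβu : IsUnit β := Int.isUnit_iff.2 hβ
  have hδu : IsUnit δ := Int.isUnit_iff.2 hδ
  have hp : (X ^ n + C β * X ^ m + C δ : ℤ[X]) = trinomial 0 m n δ β 1 := by
    rw [trinomial_def, pow_zero, C_1]; ring
  have hmir := trinomial_mirror (R := ℤ) (v := β) hm hlt hδu.ne_zero one_ne_zero
  have hunit : (trinomial 0 m n δ β 1).IsUnitTrinomial :=
    ⟨0, m, n, hm, hlt, hδu.unit, hβu.unit, 1, rfl⟩
  rw [hp]
  refine hunit.irreducible_of_coprime' fun z ⟨h₁, h₂⟩ => ?_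
  rw [hmir] at h₂
  simp only [trinomial_def, map_add, map_mul, map_pow, aeval_X, map_one, pow_zero,
    mul_one, one_mul, add_zero, eq_intCast, map_intCast] at h₁ h₂
  subst hn₁ hm₁
  exact not_common_root_of_not_three_dvd hcop hlt hβ hδ h3 (z := z)
    (by linear_combination h₁) (by linear_combination h₂)
end

section
/- Let c ∈ ℤ with |c| ≥ 2, and write |c| = ∏_{j=1}^{k} p_j^{m_j} with p_1, …, p_k pairwise distinct primes and m_j ≥ 1. Let n ≥ 1 be an integer. If gcd(m_1, …, m_k, n) = 1, then the binomial X^n + c is irreducible in ℤ[X]. -/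
open Polynomial

/-- A monic integer factor of a binomial `X ^ n + c` has constant term of absolute value
`|c| ^ (d / n)`, where `d` is the degree of the factor. -/
theorem natAbs_coeff_zero_pow_of_dvd_X_pow_add_C {f : ℤ[X]} (hf : f.Monic) {c : ℤ} {n : ℕ}
    (hdvd : f ∣ X ^ n + C c) :
    (f.coeff 0).natAbs ^ n = c.natAbs ^ f.natDegree := by
  set F : ℂ[X] := f.map (Int.castRingHom ℂ) with hF
  have hFm : F.Monic := hf.map _
  have hsplit : F.Splits := IsAlgClosed.splits F
  have hdeg : F.natDegree = f.natDegree := hf.natDegree_map _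
  have hroot : ∀ z ∈ F.roots, z ^ n = -(c : ℂ) := by
    intro z hz
    have hz0 : F.eval z = 0 := (mem_roots'.1 hz).2
    obtain ⟨g, hg⟩ := hdvd
    have h := congrArg (fun q : ℤ[X] ↦ (q.map (Int.castRingHom ℂ)).eval z) hg
    simp only [Polynomial.map_mul, eval_mul, ← hF, hz0, zero_mul] at h
    simpa [eq_neg_iff_add_eq_zero] using h
  have hprod : F.roots.prod ^ n = (-(c : ℂ)) ^ f.natDegree := by
    rw [← F.roots.map_id', ← Multiset.prod_map_pow, Multiset.map_congr rfl hroot,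
      Multiset.map_const', Multiset.prod_replicate, ← hdeg, hsplit.natDegree_eq_card_roots]
  have hcoeff : (f.coeff 0 : ℂ) = (-1) ^ f.natDegree * F.roots.prod := by
    have h := hsplit.coeff_zero_eq_prod_roots_of_monic hFm
    rwa [hdeg, hF, coeff_map] at h
  have hpow : f.coeff 0 ^ n = ((-1) ^ f.natDegree) ^ n * (-c) ^ f.natDegree := by
    have h : (f.coeff 0 : ℂ) ^ n = ((-1) ^ f.natDegree) ^ n * (-(c : ℂ)) ^ f.natDegree := by
      rw [hcoeff, mul_pow, hprod]
    exact_mod_cast h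
  simpa [Int.natAbs_mul, Int.natAbs_pow] using congrArg Int.natAbs hpow

theorem factorization_prod_prime_pow {ι : Type*} [Fintype ι] {p m : ι → ℕ}
    (hp : ∀ j, (p j).Prime) (hpinj : Function.Injective p) (i : ι) :
    (∏ j, p j ^ m j).factorization (p i) = m i := by
  classical
  rw [Nat.factorization_prod_apply fun j _ ↦ pow_ne_zero _ (hp j).ne_zero,
    Finset.sum_eq_single i]
  · simp [(hp i).factorization_self]
  · intro j _ hj
    simp [(hp j).factorization, hpinj.ne hj]
  · simp

/-- Irreducibility of binomials `X^n + c`: let `c ∈ ℤ` with `|c| ≥ 2` and write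
`|c| = ∏_{j=1}^{k} p_j^{m_j}` with `p_1, …, p_k` pairwise distinct primes and `m_j ≥ 1`.
If `gcd(m_1, …, m_k, n) = 1` then `X^n + c` is irreducible in `ℤ[X]`. -/
theorem binomial_irreducible (c : ℤ) (hc : 2 ≤ |c|) (n : ℕ) (hn : 1 ≤ n)
    (k : ℕ) (p : Fin k → ℕ) (m : Fin k → ℕ)
    (hp : ∀ j, Nat.Prime (p j)) (hpinj : Function.Injective p)
    (hm : ∀ j, 1 ≤ m j)
    (hfact : c.natAbs = ∏ j, p j ^ m j)
    (hgcd : Nat.gcd (Finset.univ.gcd m) n = 1) :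
    Irreducible (X ^ n + C c : Polynomial ℤ) := by
  have hmonic : (X ^ n + C c : ℤ[X]).Monic := monic_X_pow_add_C c (by lia)
  have hdeg : (X ^ n + C c : ℤ[X]).natDegree = n := natDegree_X_pow_add_C
  have hne : (X ^ n + C c : ℤ[X]) ≠ 1 := by
    intro h
    rw [h, natDegree_one] at hdeg
    lia
  refine hmonic.irreducible_iff_natDegree.2 ⟨hne, ?_⟩
  intro f g hf hg hfg
  have hsum : f.natDegree + g.natDegree = n := by
    rw [← hf.natDegree_mul hg, hfg, hdeg]
  have hpow := natAbs_coeff_zero_pow_of_dvd_X_pow_add_C hf ⟨g, hfg.symm⟩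
  have hdvd : n ∣ f.natDegree * Finset.univ.gcd m := by
    rw [← normalize_eq f.natDegree, ← Finset.gcd_mul_left]
    refine Finset.dvd_gcd fun j _ ↦ ⟨(f.coeff 0).natAbs.factorization (p j), ?_⟩
    have h := congrArg (fun a : ℕ ↦ a.factorization (p j)) hpow
    simpa [Nat.factorization_pow, hfact, factorization_prod_prime_pow hp hpinj]
      using h.symm
  have hnd : n ∣ f.natDegree :=
    (Nat.Coprime.symm hgcd).dvd_of_dvd_mul_right hdvd
  rcases Nat.eq_zero_or_pos f.natDegree with h | h
  · exact Or.inl h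
  · have := Nat.le_of_dvd h hnd
    right
    lia
end

section
/- Let n ≥ 2 be an integer, μ a prime number, ε ∈ {−1, 1}, and ε_i ∈ {−1, 0, 1} for 1 ≤ i ≤ ⌊n/2⌋. If μ > 1 + Σ_{i=1}^{⌊n/2⌋} |ε_i|, then the polynomial P(X) = X^n + Σ_{i=1}^{⌊n/2⌋} ε_i X^i + ε·μ is irreducible in ℤ[X]. -/
open Polynomial

/-- A non-constant monic integer polynomial all of whose complex roots lie outside the closed
unit disc has constant coefficient of absolute value greater than `1`. -/
theorem Polynomial.Monic.one_lt_abs_coeff_zero {q : ℤ[X]} (hq : q.Monic)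
    (hdeg : q.natDegree ≠ 0) (hroots : ∀ z : ℂ, aeval z q = 0 → 1 < ‖z‖) :
    1 < |q.coeff 0| := by
  have one_le_norm_prod (s : Multiset ℂ) (hs : ∀ z ∈ s, 1 < ‖z‖) : 1 ≤ ‖s.prod‖ := by
    induction s using Multiset.induction_on with
    | empty => simp
    | cons a t ih =>
      rw [Multiset.prod_cons, norm_mul]
      exact one_le_mul_of_one_le_of_one_le (hs a (by simp)).le
        (ih fun z hz => hs z (Multiset.mem_cons_of_mem hz))
  set p : ℂ[X] := q.map (Int.castRingHom ℂ) with hp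
  have hpm : p.Monic := hq.map _
  have hmem (z : ℂ) (hz : z ∈ p.roots) : 1 < ‖z‖ := by
    refine hroots z ?_
    have h := (mem_roots'.mp hz).2
    rwa [IsRoot.def, hp, eval_map, ← algebraMap_int_eq, ← aeval_def] at h
  have hcard : p.roots.card ≠ 0 := by
    rwa [← (IsAlgClosed.splits p).natDegree_eq_card_roots, hp, hq.natDegree_map]
  obtain ⟨a, ha⟩ := Multiset.card_pos_iff_exists_mem.mp (Nat.pos_of_ne_zero hcard)
  obtain ⟨t, ht⟩ := Multiset.exists_cons_of_mem ha
  have hprod : 1 < ‖p.roots.prod‖ := by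
    rw [ht, Multiset.prod_cons, norm_mul]
    refine one_lt_mul_of_lt_of_le (hmem a ha) (one_le_norm_prod t fun z hz => hmem z ?_)
    rw [ht]
    exact Multiset.mem_cons_of_mem hz
  have hnorm : ‖p.coeff 0‖ = ‖p.roots.prod‖ := by
    rw [(IsAlgClosed.splits p).coeff_zero_eq_prod_roots_of_monic hpm]
    simp
  rw [← hnorm, hp, coeff_map, eq_intCast, Complex.norm_intCast] at hprod
  exact_mod_cast hprod

/-- A monic integer polynomial with prime constant coefficient and all complex roots outside the
closed unit disc is irreducible. -/
theorem Polynomial.Monic.irreducible_of_prime_coeff_zero {p : ℤ[X]} (hp : p.Monic)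
    (hprime : Prime (p.coeff 0)) (hroots : ∀ z : ℂ, aeval z p = 0 → 1 < ‖z‖) :
    Irreducible p := by
  have hne : p ≠ 1 := by
    rintro rfl
    exact hprime.not_isUnit (by simp)
  have natDegree_eq_zero {f g : ℤ[X]} (hf : f.Monic) (hfg : f * g = p)
      (hunit : IsUnit (f.coeff 0)) : f.natDegree = 0 := by
    by_contra hdeg
    have h := hf.one_lt_abs_coeff_zero hdeg fun z hz => hroots z (by simp [← hfg, hz])
    exact h.ne' (Int.isUnit_iff_abs_eq.mp hunit)
  refine hp.irreducible_iff_natDegree.mpr ⟨hne, fun f g hf hg hfg => ?_⟩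
  have hcoeff : p.coeff 0 = f.coeff 0 * g.coeff 0 := by rw [← hfg, mul_coeff_zero]
  rcases hprime.irreducible.isUnit_or_isUnit hcoeff with h | h
  · exact Or.inl (natDegree_eq_zero hf hfg h)
  · exact Or.inr (natDegree_eq_zero hg (by rw [mul_comm, hfg]) h)

/-- Perron-type criterion with prime constant term: let `n ≥ 2`, `μ` a prime,
`ε ∈ {−1, 1}` and `ε_i ∈ {−1, 0, 1}` for `1 ≤ i ≤ ⌊n/2⌋`.  If
`μ > 1 + Σ_{i=1}^{⌊n/2⌋} |ε_i|`, then
`P(X) = X^n + Σ_{i=1}^{⌊n/2⌋} ε_i X^i + ε·μ` is irreducible in `ℤ[X]`. -/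
theorem prime_constant_irreducible (n : ℕ) (hn : 2 ≤ n)
    (μ : ℕ) (hμ : Nat.Prime μ)
    (ε : ℤ) (hε : ε = 1 ∨ ε = -1)
    (e : ℕ → ℤ) (he : ∀ i, 1 ≤ i → i ≤ n / 2 → e i = -1 ∨ e i = 0 ∨ e i = 1)
    (hbound : 1 + ∑ i ∈ Finset.Icc 1 (n / 2), |e i| < (μ : ℤ)) :
    Irreducible
      (X ^ n + (∑ i ∈ Finset.Icc 1 (n / 2), C (e i) * X ^ i) + C (ε * (μ : ℤ)) :
        Polynomial ℤ) := by
  have hdeg : (∑ i ∈ Finset.Icc 1 (n / 2), C (e i) * X ^ i + C (ε * (μ : ℤ))).degree <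
      (n : WithBot ℕ) := by
    refine (degree_add_le _ _).trans_lt (max_lt ?_ ?_)
    · refine (degree_sum_le _ _).trans_lt ((Finset.sup_lt_iff (WithBot.bot_lt_coe n)).mpr ?_)
      intro i hi
      refine (degree_C_mul_X_pow_le i _).trans_lt ?_
      have := (Finset.mem_Icc.mp hi).2
      exact Nat.cast_lt.mpr (by omega)
    · refine degree_C_le.trans_lt ?_
      exact_mod_cast (by omega : 0 < n)
  have hcoeff : (X ^ n + (∑ i ∈ Finset.Icc 1 (n / 2), C (e i) * X ^ i) + C (ε * (μ : ℤ)) :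
      ℤ[X]).coeff 0 = ε * μ := by
    have hsum : ∑ i ∈ Finset.Icc 1 (n / 2), e i * (0 : ℤ) ^ i = 0 :=
      Finset.sum_eq_zero fun i hi => by
        rw [zero_pow (by have := (Finset.mem_Icc.mp hi).1; omega), mul_zero]
    simp [coeff_zero_eq_eval_zero, eval_finsetSum, hsum, zero_pow (by omega : n ≠ 0)]
  refine Monic.irreducible_of_prime_coeff_zero ?_ ?_ fun z hz => ?_
  · rw [add_assoc]
    exact monic_X_pow_add hdeg
  · rw [hcoeff]
    have hprime := Nat.prime_iff_prime_int.mp hμ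
    rcases hε with rfl | rfl
    · simpa using hprime
    · simpa using hprime.neg
  · by_contra! hle
    have hz' : z ^ n + ∑ i ∈ Finset.Icc 1 (n / 2), (e i : ℂ) * z ^ i = -(ε * μ) := by
      simpa [eq_neg_iff_add_eq_zero] using hz
    have hεn : ‖(ε : ℂ)‖ = 1 := by rcases hε with rfl | rfl <;> simp
    have hle' : (μ : ℝ) ≤ 1 + ∑ i ∈ Finset.Icc 1 (n / 2), |(e i : ℝ)| := calc
      (μ : ℝ) = ‖z ^ n + ∑ i ∈ Finset.Icc 1 (n / 2), (e i : ℂ) * z ^ i‖ := by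
        rw [hz', norm_neg, norm_mul, hεn, one_mul, Complex.norm_natCast]
      _ ≤ ‖z ^ n‖ + ∑ i ∈ Finset.Icc 1 (n / 2), ‖(e i : ℂ) * z ^ i‖ :=
        (norm_add_le _ _).trans (by gcongr; exact norm_sum_le _ _)
      _ ≤ 1 + ∑ i ∈ Finset.Icc 1 (n / 2), |(e i : ℝ)| := by
        refine add_le_add ?_ (Finset.sum_le_sum fun i _ => ?_)
        · rw [norm_pow]
          exact pow_le_one₀ (norm_nonneg z) hle
        · rw [norm_mul, norm_pow, Complex.norm_intCast]
          exact mul_le_of_le_one_right (abs_nonneg _) (pow_le_one₀ (norm_nonneg z) hle)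
    exact hbound.not_ge (by exact_mod_cast hle')
end

section
/- Let n ≥ 2 be an integer, ε ∈ {−1, 1}, a_1 a nonzero integer, and ε_i ∈ {−1, 0, 1} for 2 ≤ i ≤ ⌊n/2⌋. If |a_1| > 2 + Σ_{i=2}^{⌊n/2⌋} |ε_i|, then the polynomial P(X) = X^n + Σ_{i=2}^{⌊n/2⌋} ε_i X^i + a_1·X + ε is irreducible in ℤ[X]. -/
open Polynomial

/-- A multiset of complex numbers outside the closed unit disc is empty or has product outside
the closed unit disc. -/
lemma one_lt_norm_multiset_prod {s : Multiset ℂ} (hs : s ≠ 0) (h : ∀ z ∈ s, 1 < ‖z‖) :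
    1 < ‖s.prod‖ := by
  induction s using Multiset.induction with
  | empty => exact absurd rfl hs
  | cons a t ih =>
    have ha : 1 < ‖a‖ := h a (Multiset.mem_cons_self a t)
    rw [Multiset.prod_cons, norm_mul]
    rcases eq_or_ne t 0 with rfl | ht
    · simpa using ha
    · nlinarith [ih ht fun z hz => h z (Multiset.mem_cons_of_mem hz)]

lemma Polynomial.Monic.exists_isRoot_norm_le_one {f : Polynomial ℂ} (hf : f.Monic)
    (hdeg : f.natDegree ≠ 0) (h0 : ‖f.coeff 0‖ ≤ 1) : ∃ z : ℂ, ‖z‖ ≤ 1 ∧ f.IsRoot z := by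
  by_contra! H
  have hsplit := IsAlgClosed.splits f
  have hroots : f.roots ≠ 0 := fun h => hdeg (by simp [hsplit.natDegree_eq_card_roots, h])
  have hprod : 1 < ‖f.roots.prod‖ := one_lt_norm_multiset_prod hroots fun z hz =>
    not_le.mp fun hle => H z hle (isRoot_of_mem_roots hz)
  have hcoeff := hsplit.coeff_zero_eq_prod_roots_of_monic hf
  rw [hcoeff] at h0
  simp only [norm_mul, norm_pow, norm_neg, norm_one, one_pow, one_mul] at h0
  linarith

/-- If the linear coefficient of `(X - α) * Q` strictly dominates the sum of the other ones and
`α` lies in the closed unit disc, then `Q` has no root in the closed unit disc. -/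
lemma not_isRoot_of_linear_coeff_dominant {Q : Polynomial ℂ} {α β : ℂ} {N : ℕ}
    (hN : Q.natDegree ≤ N) (hα : ‖α‖ ≤ 1) (hβ : ‖β‖ ≤ 1)
    (hdom : ‖((X - C α) * Q).coeff 0‖ + ∑ j ∈ Finset.range N, ‖((X - C α) * Q).coeff (j + 2)‖
      < ‖((X - C α) * Q).coeff 1‖) : ¬ Q.IsRoot β := by
  intro hroot
  have hcoeff (j : ℕ) : ((X - C α) * Q).coeff (j + 1) = Q.coeff j - α * Q.coeff (j + 1) := by
    rw [sub_mul, coeff_sub, coeff_X_mul, coeff_C_mul]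
  have hcoeff_zero : ‖((X - C α) * Q).coeff 0‖ = ‖α‖ * ‖Q.coeff 0‖ := by
    simp [mul_coeff_zero]
  have hcoeff_one : ‖((X - C α) * Q).coeff 1‖ ≤ ‖Q.coeff 0‖ + ‖α‖ * ‖Q.coeff 1‖ := by
    rw [hcoeff 0, ← norm_mul]
    exact norm_sub_le _ _
  have hshift : ∑ j ∈ Finset.range N, ‖Q.coeff (j + 2)‖ + ‖Q.coeff 1‖
      = ∑ j ∈ Finset.range N, ‖Q.coeff (j + 1)‖ := by
    have h := Finset.sum_range_succ' (fun j => ‖Q.coeff (j + 1)‖) N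
    rw [Finset.sum_range_succ, coeff_eq_zero_of_natDegree_lt (Nat.lt_succ_of_le hN), norm_zero,
      add_zero] at h
    exact h.symm
  have hsum : ∑ j ∈ Finset.range N, ‖Q.coeff (j + 1)‖
      - ‖α‖ * ∑ j ∈ Finset.range N, ‖Q.coeff (j + 2)‖
      ≤ ∑ j ∈ Finset.range N, ‖((X - C α) * Q).coeff (j + 2)‖ := by
    rw [Finset.mul_sum, ← Finset.sum_sub_distrib]
    refine Finset.sum_le_sum fun j _ => ?_
    rw [hcoeff (j + 1), ← norm_mul]
    exact norm_sub_norm_le _ _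
  have hconst : ‖Q.coeff 0‖ ≤ ∑ j ∈ Finset.range N, ‖Q.coeff (j + 1)‖ := by
    have h : Q.eval β = 0 := hroot
    rw [eval_eq_sum_range' (Nat.lt_succ_of_le hN), Finset.sum_range_succ', pow_zero, mul_one,
      add_comm] at h
    rw [eq_neg_of_add_eq_zero_left h, norm_neg]
    refine norm_sum_le_of_le _ fun j _ => ?_
    rw [norm_mul, norm_pow]
    exact mul_le_of_le_one_right (norm_nonneg _) (pow_le_one₀ (norm_nonneg _) hβ)
  rw [← hshift] at hsum hconst
  nlinarith [mul_nonneg (sub_nonneg.mpr hα) (sub_nonneg.mpr hconst)]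

/-- A monic integer polynomial with constant coefficient `±1` whose linear coefficient strictly
dominates the sum of the other ones is irreducible. -/
lemma Polynomial.Monic.irreducible_of_linear_coeff_dominant {P : Polynomial ℤ} (hP : P.Monic)
    (hP1 : P ≠ 1) (h0 : |P.coeff 0| = 1) {N : ℕ} (hN : P.natDegree ≤ N)
    (hdom : |P.coeff 0| + ∑ j ∈ Finset.range N, |P.coeff (j + 2)| < |P.coeff 1|) :
    Irreducible P := by
  rw [hP.irreducible_iff_natDegree]
  refine ⟨hP1, fun f g hf hg hfg => ?_⟩
  by_contra! hdeg
  have hunit : |f.coeff 0| * |g.coeff 0| = 1 := by rw [← abs_mul, ← mul_coeff_zero, hfg, h0]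
  have key (p : Polynomial ℤ) (hp : p.Monic) (hd : p.natDegree ≠ 0) (h : |p.coeff 0| = 1) :
      ∃ z : ℂ, ‖z‖ ≤ 1 ∧ (p.map (Int.castRingHom ℂ)).IsRoot z := by
    refine (hp.map _).exists_isRoot_norm_le_one (by rwa [hp.natDegree_map]) ?_
    rw [coeff_map, eq_intCast, Complex.norm_intCast]
    exact_mod_cast h.le
  obtain ⟨α, hα, hfα⟩ := key f hf hdeg.1
    (Int.eq_one_of_mul_eq_one_right (abs_nonneg _) hunit)
  obtain ⟨β, hβ, hgβ⟩ := key g hg hdeg.2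
    (Int.eq_one_of_mul_eq_one_left (abs_nonneg _) hunit)
  obtain ⟨f', hf'⟩ := dvd_iff_isRoot.mpr hfα
  have hPQ : P.map (Int.castRingHom ℂ) = (X - C α) * (f' * g.map (Int.castRingHom ℂ)) := by
    rw [← mul_assoc, ← hf', ← Polynomial.map_mul, hfg]
  have hQ : (f' * g.map (Int.castRingHom ℂ)).natDegree ≤ N := by
    have hd : P.natDegree = _ := (hP.natDegree_map (Int.castRingHom ℂ)).symm
    rw [hPQ, (monic_X_sub_C α).natDegree_mul'] at hd
    · omega
    · intro h
      rw [h, mul_zero] at hPQ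
      exact (hP.map (Int.castRingHom ℂ)).ne_zero hPQ
  refine not_isRoot_of_linear_coeff_dominant hQ hα hβ ?_ (root_mul_left_of_isRoot f' hgβ)
  rw [← hPQ]
  simp only [coeff_map, eq_intCast, Complex.norm_intCast]
  exact_mod_cast hdom

/-- Perron-type criterion with dominant linear coefficient: let `n ≥ 2`, `ε ∈ {−1, 1}`,
`a₁` a nonzero integer and `ε_i ∈ {−1, 0, 1}` for `2 ≤ i ≤ ⌊n/2⌋`.  If
`|a₁| > 2 + Σ_{i=2}^{⌊n/2⌋} |ε_i|`, then
`P(X) = X^n + Σ_{i=2}^{⌊n/2⌋} ε_i X^i + a₁X + ε` is irreducible in `ℤ[X]`. -/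
theorem perron_type_irreducible (n : ℕ) (hn : 2 ≤ n)
    (ε : ℤ) (hε : ε = 1 ∨ ε = -1)
    (a₁ : ℤ) (ha₁ : a₁ ≠ 0)
    (e : ℕ → ℤ) (he : ∀ i, 2 ≤ i → i ≤ n / 2 → e i = -1 ∨ e i = 0 ∨ e i = 1)
    (hbound : 2 + ∑ i ∈ Finset.Icc 2 (n / 2), |e i| < |a₁|) :
    Irreducible
      (X ^ n + (∑ i ∈ Finset.Icc 2 (n / 2), C (e i) * X ^ i) + C a₁ * X + C ε :
        Polynomial ℤ) := by
  have hcoeff (k : ℕ) : (X ^ n + (∑ i ∈ Finset.Icc 2 (n / 2), C (e i) * X ^ i) + C a₁ * X + C ε :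
      Polynomial ℤ).coeff k = (if k = n then 1 else 0)
        + (if k ∈ Finset.Icc 2 (n / 2) then e k else 0)
        + (if k = 1 then a₁ else 0) + (if k = 0 then ε else 0) := by
    simp only [coeff_add, coeff_X_pow, finsetSum_coeff, coeff_C_mul, mul_ite, mul_one, mul_zero,
      Finset.sum_ite_eq, coeff_X, coeff_C, eq_comm (a := (1 : ℕ))]
  set P : Polynomial ℤ :=
    X ^ n + (∑ i ∈ Finset.Icc 2 (n / 2), C (e i) * X ^ i) + C a₁ * X + C ε with hPdef
  have hdeg : P.natDegree ≤ n := by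
    refine natDegree_le_iff_coeff_eq_zero.mpr fun k hk => ?_
    rw [hcoeff, if_neg (by omega), if_neg (by rw [Finset.mem_Icc]; omega), if_neg (by omega),
      if_neg (by omega)]
    rfl
  have hlead : P.coeff n = 1 := by
    rw [hcoeff, if_pos rfl, if_neg (by rw [Finset.mem_Icc]; omega), if_neg (by omega),
      if_neg (by omega)]
    rfl
  have hzero : P.coeff 0 = ε := by
    rw [hcoeff, if_neg (by omega), if_neg (by simp), if_neg (by omega), if_pos rfl]
    ring
  have hone : P.coeff 1 = a₁ := by
    rw [hcoeff, if_neg (by omega), if_neg (by simp), if_pos rfl, if_neg (by omega)]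
    ring
  have hε1 : |ε| = 1 := by rcases hε with rfl | rfl <;> rfl
  refine (monic_of_natDegree_le_of_coeff_eq_one n hdeg hlead).irreducible_of_linear_coeff_dominant
    ?_ (by rw [hzero, hε1]) hdeg ?_
  · intro h
    rw [h, coeff_one, if_neg (by omega)] at hlead
    exact zero_ne_one hlead
  · have hterm (j : ℕ) : |P.coeff (j + 2)| ≤
        (if j + 2 = n then 1 else 0)
          + (if j + 2 ∈ Finset.Icc 2 (n / 2) then |e (j + 2)| else 0) := by
      rw [hcoeff, if_neg (by omega : ¬ j + 2 = 1), if_neg (by omega : ¬ j + 2 = 0), add_zero,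
        add_zero]
      refine (abs_add_le _ _).trans (le_of_eq ?_)
      split_ifs <;> simp
    have htop : ∑ j ∈ Finset.range n, (if j + 2 = n then (1 : ℤ) else 0) = 1 := by
      rw [Finset.sum_eq_single (n - 2)] <;> grind
    have hmid : ∑ j ∈ Finset.range n,
        (if j + 2 ∈ Finset.Icc 2 (n / 2) then |e (j + 2)| else 0)
        = ∑ i ∈ Finset.Icc 2 (n / 2), |e i| := by
      rw [← Finset.sum_filter]
      refine Finset.sum_nbij' (· + 2) (· - 2) ?_ ?_ ?_ ?_ ?_ <;> grind
    have hsum := Finset.sum_le_sum fun j (_ : j ∈ Finset.range n) => hterm j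
    rw [Finset.sum_add_distrib, htop, hmid] at hsum
    rw [hzero, hone, hε1]
    linarith
end

section
/- Let p be a prime and n ≥ 2 an integer with n = 2^i·3^j. (1) If j = 0, i ≥ 1 and 2n divides p − 1, then E(X) = X^n + 1 has exactly n distinct roots in ℤ/pℤ. (2) If i = 1, j ≥ 0 and 3n/2 divides p − 1, then E(X) = X^n + X^{n/2} + 1 has exactly n distinct roots in ℤ/pℤ. (3) If i ≥ 1, j ≥ 0 and 3n divides p − 1, then E(X) = X^n − X^{n/2} + 1 has exactly n distinct roots in ℤ/pℤ. In each case, for every such root γ there is a PMNS (p, n, γ, ρ)_{E} for a suitable ρ, giving n distinct PMNS. -/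
open Polynomial

/-- A divisor of `X ^ (p - 1) - 1` over `ZMod p` has as many distinct roots as its degree. -/
theorem card_roots_of_dvd_X_pow_sub_one (p : ℕ) [Fact (Nat.Prime p)] (E : (ZMod p)[X])
    (hE : E ∣ X ^ (p - 1) - 1) :
    (Finset.univ.filter (fun g : ZMod p => E.eval g = 0)).card = E.natDegree := by
  have hp := (Fact.out : Nat.Prime p)
  have hdvd : E ∣ X ^ p - X := by
    refine hE.trans ⟨X, ?_⟩
    rw [sub_mul, one_mul, pow_sub_one_mul hp.ne_zero]
  have hne : (X ^ p - X : (ZMod p)[X]) ≠ 0 :=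
    FiniteField.X_pow_card_sub_X_ne_zero (ZMod p) hp.one_lt
  have hE0 : E ≠ 0 := ne_zero_of_dvd_ne_zero hne hdvd
  have hroots : (X ^ p - X : (ZMod p)[X]).roots = Finset.univ.val := by
    simpa using FiniteField.roots_X_pow_card_sub_X (ZMod p)
  have hsplit : (X ^ p - X : (ZMod p)[X]).Splits := by
    rw [splits_iff_card_roots, hroots, FiniteField.X_pow_card_sub_X_natDegree_eq _ hp.one_lt]
    simp
  have hnodup : E.roots.Nodup :=
    Multiset.nodup_of_le (roots.le_of_dvd hne hdvd) (hroots ▸ Finset.univ.nodup)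
  rw [← splits_iff_card_roots.mp (hsplit.of_dvd hne hdvd),
    ← Multiset.toFinset_card_of_nodup hnodup]
  congr 1
  ext g
  simp [hE0]

/-- Every nonzero root modulo `p` of a monic polynomial of degree `n ≥ 2` yields a PMNS. -/
theorem exists_isPMNS_of_root (p n : ℕ) [Fact (Nat.Prime p)] (hn : 2 ≤ n) (E : ℤ[X])
    (hE : E.Monic) (hdeg : E.natDegree = n) (g : ZMod p) (hg : g ≠ 0)
    (hroot : aeval g E = 0) : ∃ ρ : ℤ, IsPMNS p n (g.val : ℤ) ρ E := by
  have hp := (Fact.out : Nat.Prime p).two_le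
  refine ⟨p, hp, hn, ?_, ?_, by exact_mod_cast hp, hE, hdeg, ?_, ?_⟩
  · exact_mod_cast Nat.pos_of_ne_zero ((ZMod.val_ne_zero g).mpr hg)
  · exact_mod_cast ZMod.val_lt g
  · rw [← ZMod.intCast_zmod_eq_zero_iff_dvd]
    have h := aeval_algebraMap_apply (ZMod p) (g.val : ℤ) E
    simpa [hroot] using h.symm
  · intro x hx0 hxp
    have : NeZero n := ⟨by lia⟩
    refine ⟨fun k => if k = 0 then x else 0, fun k => ?_, by simp⟩
    dsimp only
    split_ifs <;> lia

/-- The conclusion shared by all cases: a monic `E` of degree `n` with `E(0) = 1` which divides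
`X ^ N - 1` for some `N ∣ p - 1` has `n` roots modulo `p`, each of which yields a PMNS.
Here `P` is any description of the roots. -/
theorem card_roots_and_isPMNS (p n N : ℕ) [Fact (Nat.Prime p)] (hn : 2 ≤ n) (E : ℤ[X])
    (hE : E.Monic) (hdeg : E.natDegree = n) (hzero : E.eval 0 = 1) (hN : N ∣ p - 1)
    (hdvd : E ∣ X ^ N - 1)
    (P : ZMod p → Prop) [DecidablePred P] (hP : ∀ g, P g ↔ aeval g E = 0) :
    (Finset.univ.filter P).card = n ∧
      ∀ g : ZMod p, P g → ∃ ρ : ℤ, IsPMNS p n (g.val : ℤ) ρ E := by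
  constructor
  · have h : E.map (Int.castRingHom (ZMod p)) ∣ X ^ (p - 1) - 1 := by
      have h1 := Polynomial.map_dvd (Int.castRingHom (ZMod p))
        (hdvd.trans (pow_one_sub_dvd_pow_mul_sub_one X N ((p - 1) / N)))
      simpa [Nat.mul_div_cancel' hN] using h1
    have hcard := card_roots_of_dvd_X_pow_sub_one p _ h
    rw [hE.natDegree_map, hdeg] at hcard
    rw [← hcard]
    congr 1
    ext g
    simp [hP, aeval_def, eval_map]
  · intro g hg
    rw [hP] at hg
    refine exists_isPMNS_of_root p n hn E hE hdeg g ?_ hg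
    rintro rfl
    have h := aeval_algebraMap_apply (ZMod p) (0 : ℤ) E
    simp [hzero, hg] at h

/-- PMNS with a cyclotomic reduction polynomial: let `p` be prime and `n = 2^i·3^j ≥ 2`.
(1) If `j = 0`, `i ≥ 1` and `2n ∣ p − 1`, then `X^n + 1` has exactly `n` distinct roots
in `ℤ/pℤ`; (2) if `i = 1` and `3n/2 ∣ p − 1`, then `X^n + X^{n/2} + 1` has exactly `n`
distinct roots; (3) if `i ≥ 1` and `3n ∣ p − 1`, then `X^n − X^{n/2} + 1` has exactly `n`
distinct roots.  In each case every root `γ` yields a PMNS `(p, n, γ, ρ)_E` for a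
suitable `ρ`, giving `n` distinct PMNS. -/
theorem pmns_of_cyclotomic (p : ℕ) [Fact (Nat.Prime p)] (n i j : ℕ)
    (hn : 2 ≤ n) (hnij : n = 2 ^ i * 3 ^ j) :
    ((1 ≤ i → j = 0 → (2 * n) ∣ (p - 1) →
      (Finset.univ.filter (fun g : ZMod p => g ^ n + 1 = 0)).card = n ∧
      ∀ g : ZMod p, g ^ n + 1 = 0 →
        ∃ ρ : ℤ, IsPMNS p n ((g.val : ℤ)) ρ (X ^ n + 1)) ∧
    (i = 1 → (3 * n / 2) ∣ (p - 1) →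
      (Finset.univ.filter (fun g : ZMod p => g ^ n + g ^ (n / 2) + 1 = 0)).card = n ∧
      ∀ g : ZMod p, g ^ n + g ^ (n / 2) + 1 = 0 →
        ∃ ρ : ℤ, IsPMNS p n ((g.val : ℤ)) ρ (X ^ n + X ^ (n / 2) + 1)) ∧
    (1 ≤ i → (3 * n) ∣ (p - 1) →
      (Finset.univ.filter (fun g : ZMod p => g ^ n - g ^ (n / 2) + 1 = 0)).card = n ∧
      ∀ g : ZMod p, g ^ n - g ^ (n / 2) + 1 = 0 →
        ∃ ρ : ℤ, IsPMNS p n ((g.val : ℤ)) ρ (X ^ n - X ^ (n / 2) + 1))) := by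
  have heven : 1 ≤ i → n = 2 * (n / 2) := fun hi =>
    (Nat.mul_div_cancel' (hnij ▸ (dvd_pow_self 2 (by lia)).mul_right _)).symm
  refine ⟨fun _ _ hdvd => ?_, fun hi hdvd => ?_, fun hi hdvd => ?_⟩
  · exact card_roots_and_isPMNS p n (2 * n) hn (X ^ n + 1) (by monicity <;> lia)
      (by compute_degree; lia) (by simp; lia) hdvd ⟨X ^ n - 1, by ring⟩
      _ (fun g => by simp)
  · obtain ⟨m, rfl⟩ : ∃ m, n = 2 * m := ⟨_, heven hi.ge⟩
    have hm : 2 * m / 2 = m := by lia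
    have hm0 : m ≠ 0 := by lia
    rw [show 3 * (2 * m) / 2 = 3 * m by lia] at hdvd
    rw [hm]
    exact card_roots_and_isPMNS p (2 * m) (3 * m) hn (X ^ (2 * m) + X ^ m + 1)
      (by monicity <;> lia) (by compute_degree <;> lia) (by simp [hm0]) hdvd
      ⟨X ^ m - 1, by ring⟩ _ (fun g => by simp)
  · obtain ⟨m, rfl⟩ : ∃ m, n = 2 * m := ⟨_, heven hi⟩
    have hm : 2 * m / 2 = m := by lia
    have hm0 : m ≠ 0 := by lia
    rw [hm]
    exact card_roots_and_isPMNS p (2 * m) (3 * (2 * m)) hn (X ^ (2 * m) - X ^ m + 1)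
      (by monicity <;> lia) (by compute_degree <;> lia) (by simp [hm0]) hdvd
      ⟨(X ^ m + 1) * (X ^ (3 * m) - 1), by ring⟩ _ (fun g => by simp)
end
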